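/- arXiv:2202.10592 — 3 statements merged into one kernel-verified Lean document; each statement's English description precedes it below -/
import Mathlib

section
/- Let n ≥ 2, let Ω ⊂ ℝ^n be a bounded domain and 0 < T < ∞. Let F : (0,T) × ℝ^n × S^n → ℝ be continuous and satisfy F(t,p,X) ≤ F(t,p,Y) for all t ∈ (0,T), p ∈ ℝ^n and X ≤ Y in S^n, and let f : (0,T) → (0,T) be continuous. Suppose u is upper semicontinuous on Ω_T ∪ P_T and is a viscosity subsolution of F(t, Du, D²u + Du⊗Du) − f(t) u_t = 0 in Ω_T, and v is lower semicontinuous on Ω_T ∪ P_T and is a viscosity supersolution of F(t, Dv, D²v + Dv⊗Dv) − f(t) v_t = 0 in Ω_T. If sup_{P_T} v < ∞ and u ≤ v on P_T, then u ≤ v in Ω_T. -/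
open Set Filter Metric

noncomputable section

namespace DNLP

/-- Euclidean space ℝⁿ. -/
abbrev En (n : ℕ) := EuclideanSpace ℝ (Fin n)

/-- n×n real matrices (we use these for the symmetric matrices Sⁿ). -/
abbrev Sym (n : ℕ) := Matrix (Fin n) (Fin n) ℝ

variable {n : ℕ}

/-- Loewner order: X ≤ Y iff Y − X is positive semidefinite. -/
def LoewnerLE (X Y : Sym n) : Prop := (Y - X).PosSemidef

/-- Rank-one matrix p ⊗ q with entries pᵢ qⱼ. -/
def vouter (p q : En n) : Sym n := Matrix.of fun i j => p i * q j

/-- Spatial gradient of ψ(·,t) at y. -/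
def sgrad (ψ : En n → ℝ → ℝ) (y : En n) (t : ℝ) : En n :=
  gradient (fun x => ψ x t) y

/-- Spatial Hessian matrix of ψ(·,t) at y. -/
def shess (ψ : En n → ℝ → ℝ) (y : En n) (t : ℝ) : Sym n :=
  Matrix.of fun i j =>
    fderiv ℝ (fun x => fderiv ℝ (fun x' => ψ x' t) x (EuclideanSpace.single j (1:ℝ))) y
      (EuclideanSpace.single i (1:ℝ))

/-- Time derivative ψ_t at (y,t). -/
def tpartial (ψ : En n → ℝ → ℝ) (y : En n) (t : ℝ) : ℝ := deriv (fun s => ψ y s) t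

/-- Test functions: C² in x and C¹ in t. -/
def IsTestFn (ψ : En n → ℝ → ℝ) : Prop :=
  (∀ t, ContDiff ℝ 2 fun x => ψ x t) ∧ (∀ x, ContDiff ℝ 1 fun s => ψ x s)

/-- Condition A: continuity, H(p,0)=0 and degenerate ellipticity (monotonicity). -/
def CondA (H : En n → Sym n → ℝ) : Prop :=
  Continuous (fun q : En n × Sym n => H q.1 q.2) ∧
  (∀ p, H p 0 = 0) ∧
  ∀ (p : En n) (X Y : Sym n), LoewnerLE X Y → H p X ≤ H p Y

/-- Condition B: homogeneity of degree k₁ in the gradient and degree 1 in the Hessian. -/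
def CondB (H : En n → Sym n → ℝ) (k₁ : ℝ) : Prop :=
  0 ≤ k₁ ∧
  (∀ (θ : ℝ) (p : En n) (X : Sym n), H (θ • p) X = |θ| ^ k₁ * H p X) ∧
  ∀ (θ : ℝ), 0 < θ → ∀ (p : En n) (X : Sym n), H p (θ • X) = θ * H p X

/-- Condition C (coercivity): m(Λ) > 0 for Λ < 1 and M(Λ) < 0 for Λ ≥ Λ₁, expressed
pointwise over unit vectors (equivalent by compactness of the sphere and continuity). -/
def CondC (H : En n → Sym n → ℝ) : Prop :=
  (∀ Λ : ℝ, Λ < 1 → ∀ e : En n, ‖e‖ = 1 →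
      0 < H e (1 - Λ • vouter e e) ∧ H e (Λ • vouter e e - 1) < 0) ∧
  ∃ Λ₁ : ℝ, 1 ≤ Λ₁ ∧ ∀ Λ : ℝ, Λ₁ ≤ Λ → ∀ e : En n, ‖e‖ = 1 →
      H e (1 - Λ • vouter e e) < 0 ∧ 0 < H e (Λ • vouter e e - 1)

/-- Viscosity supersolution of H(Du,D²u) − u^{k−1} u_t = 0 on the set Q (Γ_k[u] ≤ 0). -/
def ParSuper (H : En n → Sym n → ℝ) (k : ℝ) (Q : Set (En n × ℝ)) (u : En n → ℝ → ℝ) : Prop :=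
  ∀ ψ : En n → ℝ → ℝ, IsTestFn ψ → ∀ y t, (y, t) ∈ Q →
    IsLocalMinOn (fun p : En n × ℝ => u p.1 p.2 - ψ p.1 p.2) Q (y, t) →
    H (sgrad ψ y t) (shess ψ y t) - u y t ^ (k - 1) * tpartial ψ y t ≤ 0

/-- Viscosity subsolution of H(Du,D²u) − u^{k−1} u_t = 0 on the set Q (Γ_k[u] ≥ 0). -/
def ParSub (H : En n → Sym n → ℝ) (k : ℝ) (Q : Set (En n × ℝ)) (u : En n → ℝ → ℝ) : Prop :=
  ∀ ψ : En n → ℝ → ℝ, IsTestFn ψ → ∀ y t, (y, t) ∈ Q →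
    IsLocalMaxOn (fun p : En n × ℝ => u p.1 p.2 - ψ p.1 p.2) Q (y, t) →
    0 ≤ H (sgrad ψ y t) (shess ψ y t) - u y t ^ (k - 1) * tpartial ψ y t

/-- The parabolic cylinder Ω_T = Ω × (0,T). -/
def pcyl (Ω : Set (En n)) (T : ℝ) : Set (En n × ℝ) := Ω ×ˢ Ioo 0 T

/-- The parabolic boundary P_T = (cl(Ω) × {0}) ∪ (∂Ω × [0,T)). -/
def pbdry (Ω : Set (En n)) (T : ℝ) : Set (En n × ℝ) :=
  (closure Ω ×ˢ ({0} : Set ℝ)) ∪ (frontier Ω ×ˢ Ico 0 T)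

/-- Ω_∞ = Ω × (0,∞). -/
def pcylInf (Ω : Set (En n)) : Set (En n × ℝ) := Ω ×ˢ Ioi 0

/-- P_∞ = (cl(Ω) × {0}) ∪ (∂Ω × [0,∞)). -/
def pbdryInf (Ω : Set (En n)) : Set (En n × ℝ) :=
  (closure Ω ×ˢ ({0} : Set ℝ)) ∪ (frontier Ω ×ˢ Ici 0)

/-- Viscosity subsolution of F(t,Du,D²u + Du⊗Du) − f(t) u_t = 0 on Q. -/
def ParSubF (F : ℝ → En n → Sym n → ℝ) (f : ℝ → ℝ) (Q : Set (En n × ℝ))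
    (u : En n → ℝ → ℝ) : Prop :=
  ∀ ψ : En n → ℝ → ℝ, IsTestFn ψ → ∀ y t, (y, t) ∈ Q →
    IsLocalMaxOn (fun p : En n × ℝ => u p.1 p.2 - ψ p.1 p.2) Q (y, t) →
    0 ≤ F t (sgrad ψ y t) (shess ψ y t + vouter (sgrad ψ y t) (sgrad ψ y t))
        - f t * tpartial ψ y t

/-- Viscosity supersolution of F(t,Du,D²u + Du⊗Du) − f(t) u_t = 0 on Q. -/
def ParSuperF (F : ℝ → En n → Sym n → ℝ) (f : ℝ → ℝ) (Q : Set (En n × ℝ))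
    (u : En n → ℝ → ℝ) : Prop :=
  ∀ ψ : En n → ℝ → ℝ, IsTestFn ψ → ∀ y t, (y, t) ∈ Q →
    IsLocalMinOn (fun p : En n × ℝ => u p.1 p.2 - ψ p.1 p.2) Q (y, t) →
    F t (sgrad ψ y t) (shess ψ y t + vouter (sgrad ψ y t) (sgrad ψ y t))
        - f t * tpartial ψ y t ≤ 0

/-- Viscosity subsolution of H(Dw, D²w + Dw⊗Dw) − w_t = 0 on Q. -/
def ParSubLog (H : En n → Sym n → ℝ) (Q : Set (En n × ℝ)) (w : En n → ℝ → ℝ) : Prop :=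
  ParSubF (fun _ p X => H p X) (fun _ => 1) Q w

/-- Viscosity supersolution of H(Dw, D²w + Dw⊗Dw) − w_t = 0 on Q. -/
def ParSuperLog (H : En n → Sym n → ℝ) (Q : Set (En n × ℝ)) (w : En n → ℝ → ℝ) : Prop :=
  ParSuperF (fun _ p X => H p X) (fun _ => 1) Q w

/-- Hessian matrix of φ : ℝⁿ → ℝ at y. -/
def ehess (φ : En n → ℝ) (y : En n) : Sym n :=
  Matrix.of fun i j =>
    fderiv ℝ (fun x => fderiv ℝ φ x (EuclideanSpace.single j (1:ℝ))) y
      (EuclideanSpace.single i (1:ℝ))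

/-- Elliptic viscosity condition H(Du,D²u) ≥ f in Ω (subsolution). -/
def EllSub (H : En n → Sym n → ℝ) (Ω : Set (En n)) (u : En n → ℝ) (f : En n → ℝ) : Prop :=
  ∀ φ : En n → ℝ, ContDiff ℝ 2 φ → ∀ y ∈ Ω,
    IsLocalMaxOn (fun x => u x - φ x) Ω y →
    f y ≤ H (gradient φ y) (ehess φ y)

/-- Elliptic viscosity condition H(Dv,D²v) ≤ f in Ω (supersolution). -/
def EllSuper (H : En n → Sym n → ℝ) (Ω : Set (En n)) (v : En n → ℝ) (f : En n → ℝ) : Prop :=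
  ∀ φ : En n → ℝ, ContDiff ℝ 2 φ → ∀ y ∈ Ω,
    IsLocalMinOn (fun x => v x - φ x) Ω y →
    H (gradient φ y) (ehess φ y) ≤ f y

/-- Uniform outer ball condition. -/
def UnifOuterBall (Ω : Set (En n)) : Prop :=
  ∃ ρ₀ : ℝ, 0 < ρ₀ ∧ ∀ y ∈ frontier Ω, ∃ q : En n,
    q ∉ Ω ∧ Metric.ball q ρ₀ ⊆ Ωᶜ ∧ y ∈ Metric.sphere q ρ₀

/-- Outer ball condition (radius may vary with the boundary point). -/
def OuterBallCond (Ω : Set (En n)) : Prop :=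
  ∀ y ∈ frontier Ω, ∃ ρ : ℝ, 0 < ρ ∧ ∃ q : En n,
    q ∉ Ω ∧ Metric.ball q ρ ⊆ Ωᶜ ∧ y ∈ Metric.sphere q ρ

section Hilbert

open scoped Topology RealInnerProductSpace

theorem upperSemicontinuousOn_prod_sub {X : Type*} [TopologicalSpace X] {K : Set X} {u v : X → ℝ}
    (hu : UpperSemicontinuousOn u K) (hv : LowerSemicontinuousOn v K) :
    UpperSemicontinuousOn (fun q : X × X => u q.1 - v q.2) (K ×ˢ K) := by
  have h1 : UpperSemicontinuousOn (fun q : X × X => u q.1) (K ×ˢ K) :=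
    hu.comp continuous_fst.continuousOn fun q hq => hq.1
  have h2 : LowerSemicontinuousOn (fun q : X × X => v q.2) (K ×ˢ K) :=
    hv.comp continuous_snd.continuousOn fun q hq => hq.2
  have h3 : UpperSemicontinuousOn (fun q : X × X => -v q.2) (K ×ˢ K) :=
    continuous_neg.comp_lowerSemicontinuousOn_antitone h2 fun _ _ h => neg_le_neg h
  simpa only [sub_eq_add_neg] using h1.add h3

variable {H : Type*} [NormedAddCommGroup H] [InnerProductSpace ℝ H]

theorem le_affine_of_concaveOn_of_le_quadratic {h : H → ℝ} (hc : ConcaveOn ℝ univ h) {y p : H}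
    {C : ℝ} (hq : ∀ d, h (y + d) ≤ h y + ⟪p, d⟫ + C * ‖d‖ ^ 2) (d : H) :
    h (y + d) ≤ h y + ⟪p, d⟫ := by
  by_contra! hlt
  set a := h (y + d) - h y - ⟪p, d⟫ with ha
  have ha0 : 0 < a := by linarith
  have key : ∀ s : ℝ, 0 ≤ s → s ≤ 1 → s * a ≤ C * (s ^ 2 * ‖d‖ ^ 2) := by
    intro s hs0 hs1
    have h1 := hc.2 (mem_univ y) (mem_univ (y + d)) (sub_nonneg.2 hs1) hs0 (by ring)
    have h2 : (1 - s) • y + s • (y + d) = y + s • d := by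
      rw [smul_add, sub_smul, one_smul]; abel
    rw [h2] at h1
    have h3 := hq (s • d)
    rw [inner_smul_right, norm_smul, mul_pow, Real.norm_eq_abs, sq_abs] at h3
    simp only [smul_eq_mul] at h1
    rw [ha]
    nlinarith
  set M := C * ‖d‖ ^ 2 with hM
  have hM1 : a ≤ M := by simpa [hM] using key 1 zero_le_one le_rfl
  have hM0 : 0 < M := ha0.trans_le hM1
  have h5 := key (a / (2 * M)) (by positivity) (by rw [div_le_one (by positivity)]; linarith)
  have h6 : C * ((a / (2 * M)) ^ 2 * ‖d‖ ^ 2) = a / (2 * M) * (a / 2) := by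
    have : C * ((a / (2 * M)) ^ 2 * ‖d‖ ^ 2) = (a / (2 * M)) ^ 2 * M := by rw [hM]; ring
    rw [this]; field_simp
  rw [h6] at h5
  have h7 : 0 < a / (2 * M) := by positivity
  nlinarith

/-- The supremal convolution `V` of a semiconcave function `g` is of class `C^{1,1}`, in the form of
a two-sided quadratic bound. -/
theorem exists_quadratic_bound_of_supConvolution {g V : H → ℝ}
    (hc : ConcaveOn ℝ univ fun y => g y - 1 / 4 * ‖y‖ ^ 2)
    (hV : ∀ z y, g y - 1 / 2 * ‖z - y‖ ^ 2 ≤ V z)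
    (hatt : ∀ z, ∃ y, V z = g y - 1 / 2 * ‖z - y‖ ^ 2) :
    ∃ P : H → H, ∀ z d, |V (z + d) - V z - ⟪P z, d⟫| ≤ 1 / 2 * ‖d‖ ^ 2 := by
  choose Y hY using hatt
  refine ⟨fun z => Y z - z, fun z d => ?_⟩
  set y := Y z
  have hg : ∀ s, g (y + s) ≤ g y + ⟪y - z, s⟫ + 1 / 4 * ‖s‖ ^ 2 := by
    intro s
    have := le_affine_of_concaveOn_of_le_quadratic hc (y := y) (p := y - z - (1 / 2 : ℝ) • y)
      (C := 1 / 4) (fun e => ?_) s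
    · simp only [← real_inner_self_eq_norm_sq, inner_add_left, inner_add_right, inner_sub_left,
        inner_smul_left, real_inner_comm, RCLike.conj_to_real] at this ⊢
      linarith
    · have h1 := hV z (y + e)
      rw [hY z] at h1
      simp only [← real_inner_self_eq_norm_sq, inner_add_left, inner_add_right, inner_sub_left,
        inner_sub_right, inner_smul_left, real_inner_comm, RCLike.conj_to_real] at h1 ⊢
      simp only [y] at h1 ⊢
      linarith
  rw [abs_le]
  constructor
  · have h1 := hV (z + d) y
    have h2 := hY z
    simp only [← real_inner_self_eq_norm_sq, inner_add_left, inner_add_right, inner_sub_left,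
        inner_sub_right, real_inner_comm] at h1 h2 ⊢
    simp only [y] at h1 h2 ⊢
    linarith
  · have h1 := hY (z + d)
    have h2 := hY z
    have h3 := hg (Y (z + d) - y)
    have h4 : 0 ≤ ‖d - (1 / 2 : ℝ) • (Y (z + d) - y)‖ ^ 2 := by positivity
    rw [add_sub_cancel] at h3
    simp only [← real_inner_self_eq_norm_sq, inner_add_left, inner_add_right, inner_sub_left,
        inner_sub_right, inner_smul_left, inner_smul_right, real_inner_comm,
        RCLike.conj_to_real] at h1 h2 h3 h4 ⊢
    simp only [y] at h1 h2 h3 h4 ⊢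
    linarith

theorem hasGradientAt_of_quadratic_bound [CompleteSpace H] {V : H → ℝ} {P : H → H}
    (hP : ∀ z d, |V (z + d) - V z - ⟪P z, d⟫| ≤ 1 / 2 * ‖d‖ ^ 2) (z : H) :
    HasGradientAt V (P z) z := by
  rw [hasGradientAt_iff_isLittleO_nhds_zero]
  refine Asymptotics.IsBigO.trans_isLittleO (g := fun d : H => ‖d‖ ^ 2) ?_ ?_
  · refine Asymptotics.IsBigO.of_bound (1 / 2) (Eventually.of_forall fun d => ?_)
    simpa using hP z d
  · exact Asymptotics.isLittleO_norm_pow_id one_lt_two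

theorem lipschitzWith_of_quadratic_bound {V : H → ℝ} {P : H → H}
    (hP : ∀ z d, |V (z + d) - V z - ⟪P z, d⟫| ≤ 1 / 2 * ‖d‖ ^ 2) :
    LipschitzWith 3 P := by
  refine LipschitzWith.of_dist_le_mul fun z w => ?_
  rw [dist_eq_norm, dist_eq_norm]
  obtain ⟨d, rfl⟩ : ∃ d, z = w + d := ⟨z - w, by abel⟩
  simp only [add_sub_cancel_left, NNReal.coe_ofNat]
  set D := P (w + d) - P w with hD
  by_contra! hlt
  have key : ∀ e, ⟪D, e⟫ ≤ 1 / 2 * ‖d + e‖ ^ 2 + 1 / 2 * ‖d‖ ^ 2 + 1 / 2 * ‖e‖ ^ 2 := by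
    intro e
    have h1 := (abs_le.1 (hP w (d + e))).2
    have h2 := (abs_le.1 (hP w d)).1
    have h3 := (abs_le.1 (hP (w + d) e)).1
    rw [← add_assoc, inner_add_right] at h1
    rw [hD, inner_sub_left]
    linarith
  have hn : ‖D‖ ≠ 0 := fun h0 => by rw [h0] at hlt; linarith [norm_nonneg d]
  have hDpos : 0 < ‖D‖ := lt_of_le_of_ne (norm_nonneg _) hn.symm
  have h1 := key ((1 / 3 : ℝ) • D)
  have h2 : ‖(1 / 3 : ℝ) • D‖ = 1 / 3 * ‖D‖ := by rw [norm_smul]; norm_num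
  have h3 : ‖d + (1 / 3 : ℝ) • D‖ ≤ ‖d‖ + 1 / 3 * ‖D‖ := h2 ▸ norm_add_le _ _
  rw [inner_smul_right, real_inner_self_eq_norm_sq, h2] at h1
  have h4 : ‖d + (1 / 3 : ℝ) • D‖ ^ 2 ≤ (‖d‖ + 1 / 3 * ‖D‖) ^ 2 :=
    pow_le_pow_left₀ (norm_nonneg _) h3 2
  nlinarith [norm_nonneg d]

theorem second_order_expansion {V : H → ℝ} {P : H → H} [CompleteSpace H]
    (hV : ∀ z, HasGradientAt V (P z) z) {z : H} {A : H →L[ℝ] H} (hA : HasFDerivAt P A z)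
    {η : ℝ} (hη : 0 < η) :
    ∀ᶠ h in 𝓝 (0 : H), |V (z + h) - V z - ⟪P z, h⟫ - 1 / 2 * ⟪A h, h⟫| ≤ η * ‖h‖ ^ 2 := by
  have h1 := (hasFDerivAt_iff_isLittleO_nhds_zero.1 hA).def hη
  obtain ⟨r, hr, hball⟩ := Metric.eventually_nhds_iff_ball.1 h1
  filter_upwards [Metric.ball_mem_nhds (0 : H) hr] with h hh
  set φ : ℝ → ℝ := fun s => V (z + s • h) - s * ⟪P z, h⟫ - s ^ 2 / 2 * ⟪A h, h⟫ with hφ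
  have hd : ∀ s : ℝ, HasDerivAt φ (⟪P (z + s • h), h⟫ - ⟪P z, h⟫ - s * ⟪A h, h⟫) s := by
    intro s
    have e1 : HasDerivAt (fun s : ℝ => z + s • h) h s := by
      simpa using ((hasDerivAt_id s).smul_const h).const_add z
    have e2 := (hV (z + s • h)).hasFDerivAt.comp_hasDerivAt s e1
    have e3 := (hasDerivAt_id s).mul_const ⟪P z, h⟫
    have e4 := ((hasDerivAt_pow 2 s).div_const 2).mul_const ⟪A h, h⟫
    have e5 : HasDerivAt φ _ s := (e2.sub e3).sub e4
    refine e5.congr_deriv ?_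
    simp
  have hb := norm_image_sub_le_of_norm_deriv_le_segment_01' (f := φ) (C := η * ‖h‖ ^ 2)
    (fun s _ => (hd s).hasDerivWithinAt) (fun s hs => ?_)
  · simp only [hφ, one_smul, zero_smul, add_zero, Real.norm_eq_abs] at hb
    convert hb using 2
    ring
  · have hs' : s • h ∈ ball (0 : H) r := by
      rw [mem_ball_zero_iff] at hh ⊢
      rw [norm_smul, Real.norm_eq_abs, abs_of_nonneg hs.1]
      nlinarith [norm_nonneg h, hs.2, hs.1]
    have h2 := hball _ hs'
    have h3 : ⟪P (z + s • h), h⟫ - ⟪P z, h⟫ - s * ⟪A h, h⟫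
        = ⟪P (z + s • h) - P z - A (s • h), h⟫ := by
      rw [map_smul, inner_sub_left, inner_sub_left, inner_smul_left]; simp
    rw [h3]
    refine (norm_inner_le_norm _ _).trans ?_
    rw [norm_smul, Real.norm_eq_abs, abs_of_nonneg hs.1] at h2
    calc _ ≤ η * (s * ‖h‖) * ‖h‖ := by gcongr
      _ ≤ η * (1 * ‖h‖) * ‖h‖ := by gcongr; exact hs.2.le
      _ = _ := by ring

theorem exists_supConvolution [FiniteDimensional ℝ H] {K : Set H} (hK : IsCompact K)
    (hne : K.Nonempty) {v : H → ℝ} (hv : LowerSemicontinuousOn v K) :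
    ∃ (V : H → ℝ) (P : H → H), (∀ z d, |V (z + d) - V z - ⟪P z, d⟫| ≤ 1 / 2 * ‖d‖ ^ 2) ∧
      (∀ (z x : H) (b : ℝ), (∀ y ∈ K, b ≤ v y + 1 / 4 * ‖x - y‖ ^ 2) →
        b - 1 / 2 * ‖z - x‖ ^ 2 ≤ V z) ∧
      ∀ z, ∀ y ∈ K, V z ≤ v y + 1 / 2 * ‖z - y‖ ^ 2 := by
  have hW : ∀ x : H, ∃ w ∈ K, IsMinOn (fun y => v y + 1 / 4 * ‖x - y‖ ^ 2) K w := fun x => by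
    have h1 : LowerSemicontinuousOn (fun y : H => 1 / 4 * ‖x - y‖ ^ 2) K :=
      (Continuous.lowerSemicontinuous (by fun_prop)).lowerSemicontinuousOn _
    exact LowerSemicontinuousOn.exists_isMinOn hne hK (hv.add h1)
  choose W hWK hWmin using hW
  set g : H → ℝ := fun x => v (W x) + 1 / 4 * ‖x - W x‖ ^ 2 with hg
  have hgle : ∀ x, ∀ y ∈ K, g x ≤ v y + 1 / 4 * ‖x - y‖ ^ 2 := fun x y hy => hWmin x hy
  have hc : ConcaveOn ℝ univ fun y => g y - 1 / 4 * ‖y‖ ^ 2 := by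
    refine ⟨convex_univ, fun x _ y _ a b ha hb hab => ?_⟩
    have h1 := hgle x _ (hWK (a • x + b • y))
    have h2 := hgle y _ (hWK (a • x + b • y))
    have h3 : g (a • x + b • y) = v (W (a • x + b • y))
      + 1 / 4 * ‖a • x + b • y - W (a • x + b • y)‖ ^ 2 := rfl
    obtain rfl : b = 1 - a := by linarith
    set w := W (a • x + (1 - a) • y)
    beta_reduce
    rw [h3, norm_sub_sq_real]
    rw [norm_sub_sq_real] at h1 h2
    simp only [smul_eq_mul, inner_add_left, inner_smul_left, RCLike.conj_to_real]
    nlinarith [mul_le_mul_of_nonneg_left h1 ha, mul_le_mul_of_nonneg_left h2 hb]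
  have hgc : Continuous g := by
    have h1 := hc.locallyLipschitz.continuous
    have h2 : Continuous fun y : H => 1 / 4 * ‖y‖ ^ 2 := by fun_prop
    exact (h1.add h2).congr fun y => by simp
  have hatt : ∀ z, ∃ y, ∀ y', g y' - 1 / 2 * ‖z - y'‖ ^ 2 ≤ g y - 1 / 2 * ‖z - y‖ ^ 2 := by
    intro z
    obtain ⟨w, hw⟩ := hne
    refine Continuous.exists_forall_ge' (f := fun y => g y - 1 / 2 * ‖z - y‖ ^ 2)
      (by fun_prop) z ?_
    have ht := tendsto_dist_right_cocompact_atTop z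
    filter_upwards [ht.eventually_ge_atTop 1,
      ht.eventually_ge_atTop (8 * |v w + 3 / 4 * ‖z - w‖ ^ 2 - g z|)] with y hy1 hy2
    have h1 := hgle y w hw
    rw [dist_comm, dist_eq_norm] at hy1 hy2
    have h3 : ‖y - w‖ ^ 2 ≤ (‖z - y‖ + ‖z - w‖) ^ 2 := by
      refine pow_le_pow_left₀ (norm_nonneg _) ?_ 2
      have : y - w = (z - w) - (z - y) := by abel
      rw [this, add_comm]
      exact norm_sub_le _ _
    have h4 := le_abs_self (v w + 3 / 4 * ‖z - w‖ ^ 2 - g z)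
    simp only [sub_self, norm_zero]
    nlinarith [sq_nonneg (‖z - y‖ - 2 * ‖z - w‖)]
  choose Y hY using hatt
  refine ⟨fun z => g (Y z) - 1 / 2 * ‖z - Y z‖ ^ 2, ?_⟩
  obtain ⟨P, hP⟩ := exists_quadratic_bound_of_supConvolution
    (V := fun z => g (Y z) - 1 / 2 * ‖z - Y z‖ ^ 2) hc hY (fun z => ⟨Y z, rfl⟩)
  refine ⟨P, hP, fun z x b hb => ?_, fun z y hy => ?_⟩
  · exact (sub_le_sub_right (hb _ (hWK x)) _).trans (hY z x)
  · have h1 := hgle (Y z) y hy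
    have h2 : 0 ≤ ‖(z - y) - (1 / 2 : ℝ) • (Y z - y)‖ ^ 2 := by positivity
    simp only [← real_inner_self_eq_norm_sq, inner_sub_left,
        inner_sub_right, inner_smul_left, inner_smul_right, real_inner_comm,
        RCLike.conj_to_real] at h1 h2 ⊢
    linarith

theorem exists_isMax_doubling {K : Set H} (hK : IsCompact K)
    (hne : K.Nonempty) {u v : H → ℝ} (hu : UpperSemicontinuousOn u K)
    (hv : LowerSemicontinuousOn v K) (p : H) :
    ∃ x ∈ K, ∃ y ∈ K, ∀ x' ∈ K, ∀ y' ∈ K,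
      u x' - v y' - 1 / 4 * ‖x' - y'‖ ^ 2 - 1 / 2 * ⟪p, x' + y'⟫ ≤
        u x - v y - 1 / 4 * ‖x - y‖ ^ 2 - 1 / 2 * ⟪p, x + y⟫ := by
  have h4 : UpperSemicontinuousOn
      (fun q : H × H => -(1 / 4 * ‖q.1 - q.2‖ ^ 2 + 1 / 2 * ⟪p, q.1 + q.2⟫)) (K ×ˢ K) :=
    (Continuous.upperSemicontinuous (by fun_prop)).upperSemicontinuousOn _
  obtain ⟨⟨x, y⟩, ⟨hx, hy⟩, hmax⟩ := UpperSemicontinuousOn.exists_isMaxOn (hne.prod hne)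
    (hK.prod hK) ((upperSemicontinuousOn_prod_sub hu hv).add h4)
  refine ⟨x, hx, y, hy, fun x' hx' y' hy' => ?_⟩
  have := hmax (mk_mem_prod hx' hy')
  simp only [mem_ofPred_eq] at this
  linarith

theorem norm_sub_le_of_isMax_doubling {K : Set H} {u v : H → ℝ} {p q x y x₁ y₁ : H}
    (hx : x ∈ K) (hy : y ∈ K) (hx₁ : x₁ ∈ K) (hy₁ : y₁ ∈ K)
    (hp : ∀ x' ∈ K, ∀ y' ∈ K, u x' - v y' - 1 / 4 * ‖x' - y'‖ ^ 2 - 1 / 2 * ⟪p, x' + y'⟫ ≤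
        u x - v y - 1 / 4 * ‖x - y‖ ^ 2 - 1 / 2 * ⟪p, x + y⟫)
    (hq : ∀ x' ∈ K, ∀ y' ∈ K, u x' - v y' - 1 / 4 * ‖x' - y'‖ ^ 2 - 1 / 2 * ⟪q, x' + y'⟫ ≤
        u x₁ - v y₁ - 1 / 4 * ‖x₁ - y₁‖ ^ 2 - 1 / 2 * ⟪q, x₁ + y₁⟫) :
    ‖p - q‖ ≤ 2 * ‖(1 / 2 : ℝ) • (x + y - p) - (1 / 2 : ℝ) • (x₁ + y₁ - q)‖ := by
  set D := (1 / 2 : ℝ) • (x + y - p) - (1 / 2 : ℝ) • (x₁ + y₁ - q) with hD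
  have h1 := hp _ hx₁ _ hy₁
  have h2 := hq _ hx _ hy
  have h3 : 1 / 2 * ‖p - q‖ ^ 2 ≤ -⟪p - q, D⟫ := by
    rw [hD, ← real_inner_self_eq_norm_sq]
    simp only [inner_add_right, inner_sub_left, inner_sub_right, inner_smul_right] at h1 h2 ⊢
    linarith
  have h4 := neg_le_of_abs_le (abs_real_inner_le_norm (p - q) D)
  by_contra! hlt
  nlinarith [norm_nonneg D, norm_nonneg (p - q)]

/-- A form of the theorem on sums: after an arbitrarily small linear perturbation of the doubled
functional, there is a maximum at which both functions admit one-sided second order expansions with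
the same Hessian. -/
theorem exists_second_order_contact [FiniteDimensional ℝ H] {K : Set H} (hK : IsCompact K)
    (hne : K.Nonempty) {u v : H → ℝ} (hu : UpperSemicontinuousOn u K)
    (hv : LowerSemicontinuousOn v K) {r : ℝ} (hr : 0 < r) :
    ∃ (p x y : H) (A : H →L[ℝ] H), ‖p‖ < r ∧ x ∈ K ∧ y ∈ K ∧
      (∀ x' ∈ K, ∀ y' ∈ K, u x' - v y' - 1 / 4 * ‖x' - y'‖ ^ 2 - 1 / 2 * ⟪p, x' + y'⟫ ≤
        u x - v y - 1 / 4 * ‖x - y‖ ^ 2 - 1 / 2 * ⟪p, x + y⟫) ∧ ‖A‖ ≤ 3 ∧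
      (∀ η > 0, ∀ᶠ h in 𝓝 (0 : H), x + h ∈ K →
        u (x + h) ≤ u x + 1 / 2 * ⟪x - y + p, h⟫ + 1 / 2 * ⟪A h, h⟫ + η * ‖h‖ ^ 2) ∧
      (∀ η > 0, ∀ᶠ h in 𝓝 (0 : H), y + h ∈ K →
        v y + 1 / 2 * ⟪x - y - p, h⟫ + 1 / 2 * ⟪A h, h⟫ - η * ‖h‖ ^ 2 ≤ v (y + h)) := by
  obtain ⟨V, P, hP, hVge, hVle⟩ := exists_supConvolution hK hne hv
  have hV := hasGradientAt_of_quadratic_bound hP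
  have hL := lipschitzWith_of_quadratic_bound hP
  choose X hXK Y hYK hmax using exists_isMax_doubling hK hne hu hv
  set Z : H → H := fun p => (1 / 2 : ℝ) • (X p + Y p - p) with hZ
  have hanti : AntilipschitzWith 2 Z := AntilipschitzWith.of_le_mul_dist fun p q => by
    rw [dist_eq_norm, dist_eq_norm]
    exact norm_sub_le_of_isMax_doubling (hXK p) (hYK p) (hXK q) (hYK q) (hmax p) (hmax q)
  obtain ⟨p, hpr, hdiff⟩ : ∃ p, ‖p‖ < r ∧ DifferentiableAt ℝ P (Z p) := by
    by_contra! hcon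
    borelize H
    let μ : MeasureTheory.Measure H := MeasureTheory.Measure.hausdorffMeasure (Module.finrank ℝ H)
    have h1 : ∀ᵐ z ∂μ, DifferentiableAt ℝ P z := hL.ae_differentiableAt
    have h2 : μ (Z '' ball 0 r) = 0 := by
      refine MeasureTheory.measure_mono_null ?_ h1
      rintro _ ⟨p, hp, rfl⟩
      exact hcon p (by simpa using hp)
    have h3 := hanti.le_hausdorffMeasure_image (d := Module.finrank ℝ H) (Nat.cast_nonneg _)
      (ball 0 r)
    have h4 : 0 < μ (ball 0 r) := Metric.measure_ball_pos μ 0 hr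
    change μ _ ≤ _ * μ _ at h3
    rw [h2, mul_zero] at h3
    exact h4.not_ge h3
  set x := X p
  set y := Y p
  set z := Z p with hz
  set A := fderiv ℝ P z
  have hzx : z - x = (-1 / 2 : ℝ) • (x - y + p) := by
    simp only [hz, hZ, x, y]; module
  have hzy : z - y = (1 / 2 : ℝ) • (x - y - p) := by
    simp only [hz, hZ, x, y]; module
  have hu_le : ∀ z' : H, ∀ x' ∈ K, u x' ≤
      (u x - v y - 1 / 4 * ‖x - y‖ ^ 2 - 1 / 2 * ⟪p, x + y⟫) + 1 / 4 * ‖p‖ ^ 2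
        + V z' + 1 / 2 * ‖z' - x'‖ ^ 2 + ⟪p, z'⟫ := by
    intro z' x' hx'
    have h1 := hVge z' (x' - p)
      (u x' - (u x - v y - 1 / 4 * ‖x - y‖ ^ 2 - 1 / 2 * ⟪p, x + y⟫) - 1 / 4 * ‖p‖ ^ 2
        - ⟪p, x'⟫ + 1 / 2 * ‖p‖ ^ 2) (fun y' hy' => ?_)
    · simp only [← real_inner_self_eq_norm_sq, inner_sub_left, inner_sub_right,
        real_inner_comm] at h1 ⊢
      linarith
    · have h2 := hmax p x' hx' y' hy'
      change _ ≤ u x - v y - 1 / 4 * ‖x - y‖ ^ 2 - 1 / 2 * ⟪p, x + y⟫ at h2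
      simp only [← real_inner_self_eq_norm_sq, inner_add_right, inner_sub_left, inner_sub_right,
        real_inner_comm] at h2 ⊢
      linarith
  have hv_ge : ∀ z' : H, ∀ y' ∈ K, V z' - 1 / 2 * ‖z' - y'‖ ^ 2 ≤ v y' := fun z' y' hy' => by
    linarith [hVle z' y' hy']
  have hVz : u x = (u x - v y - 1 / 4 * ‖x - y‖ ^ 2 - 1 / 2 * ⟪p, x + y⟫) + 1 / 4 * ‖p‖ ^ 2
        + V z + 1 / 2 * ‖z - x‖ ^ 2 + ⟪p, z⟫ ∧ V z - 1 / 2 * ‖z - y‖ ^ 2 = v y := by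
    have h1 := hu_le z x (hXK p)
    have h2 := hv_ge z y (hYK p)
    have h3 : ⟪p, z⟫ = 1 / 2 * ⟪p, x + y⟫ - 1 / 2 * ‖p‖ ^ 2 := by
      simp only [hz, hZ, x, y, ← real_inner_self_eq_norm_sq, inner_smul_right, inner_sub_right]
      ring
    have h4 : 1 / 2 * ‖z - x‖ ^ 2 + 1 / 2 * ‖z - y‖ ^ 2 = 1 / 4 * ‖x - y‖ ^ 2 + 1 / 4 * ‖p‖ ^ 2 := by
      rw [hzx, hzy, ← real_inner_self_eq_norm_sq, ← real_inner_self_eq_norm_sq,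
        ← real_inner_self_eq_norm_sq, ← real_inner_self_eq_norm_sq]
      simp only [inner_smul_left, inner_smul_right, inner_add_left, inner_add_right, inner_sub_left,
        inner_sub_right, real_inner_comm, RCLike.conj_to_real]
      ring
    constructor <;> linarith
  have hPz : P z = z - y := by
    have key : ∀ d, ⟪P z - (z - y), d⟫ ≤ ‖d‖ ^ 2 := by
      intro d
      have h1 := (abs_le.1 (hP z d)).1
      have h2 := hv_ge (z + d) y (hYK p)
      have h3 : ‖z + d - y‖ ^ 2 = ‖z - y‖ ^ 2 + 2 * ⟪z - y, d⟫ + ‖d‖ ^ 2 := by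
        rw [← norm_add_sq_real]; congr 2; abel
      rw [inner_sub_left]
      linarith [hVz.2]
    have h1 := key ((1 / 2 : ℝ) • (P z - (z - y)))
    rw [inner_smul_right, real_inner_self_eq_norm_sq, norm_smul, mul_pow] at h1
    norm_num at h1
    have h2 : ‖P z - (z - y)‖ = 0 := by nlinarith [norm_nonneg (P z - (z - y))]
    exact sub_eq_zero.1 (norm_eq_zero.1 h2)
  refine ⟨p, x, y, A, hpr, hXK p, hYK p, hmax p, ?_, fun η hη => ?_, fun η hη => ?_⟩
  · exact_mod_cast norm_fderiv_le_of_lipschitz ℝ hL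
  · filter_upwards [second_order_expansion hV hdiff.hasFDerivAt hη] with h hh hxh
    have h1 := hu_le (z + h) _ hxh
    have h2 := (abs_le.1 hh).2
    rw [add_sub_add_right_eq_sub, inner_add_right p z h] at h1
    rw [hPz, hzy, inner_smul_left] at h2
    simp only [RCLike.conj_to_real, inner_sub_left, inner_add_left] at h2 ⊢
    linarith [hVz.1]
  · filter_upwards [second_order_expansion hV hdiff.hasFDerivAt hη] with h hh hyh
    have h1 := hv_ge (z + h) _ hyh
    have h2 := (abs_le.1 hh).1
    rw [add_sub_add_right_eq_sub] at h1
    rw [hPz, hzy, inner_smul_left] at h2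
    simp only [RCLike.conj_to_real] at h2
    linarith [hVz.2]

end Hilbert

section TestFunctions

open scoped Topology RealInnerProductSpace

variable {n : ℕ}

/-- The symmetric matrix of the quadratic form of a linear operator. -/
def symMatrix (B : En n →L[ℝ] En n) : Sym n := Matrix.of fun i j =>
  1 / 2 * (⟪B (EuclideanSpace.single i 1), EuclideanSpace.single j 1⟫ +
    ⟪B (EuclideanSpace.single j 1), EuclideanSpace.single i 1⟫)

theorem continuous_symMatrix : Continuous (symMatrix : (En n →L[ℝ] En n) → Sym n) := by
  unfold symMatrix
  refine continuous_matrix fun i j => ?_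
  simp only [Matrix.of_apply]
  fun_prop

/-- Parabolic quadratic test function. -/
def paraboloid (y : En n) (t : ℝ) (q : En n) (τ : ℝ) (B : En n →L[ℝ] En n) (C : ℝ)
    (x : En n) (s : ℝ) : ℝ :=
  ⟪q, x - y⟫ + τ * (s - t) + 1 / 2 * ⟪B (x - y), x - y⟫ + C * (s - t) ^ 2

variable {y : En n} {t : ℝ} {q : En n} {τ : ℝ} {B : En n →L[ℝ] En n} {C : ℝ}

theorem isTestFn_paraboloid : IsTestFn (paraboloid y t q τ B C) := by
  unfold paraboloid
  refine ⟨fun s => ?_, fun x => ?_⟩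
  · have h0 : ContDiff ℝ 2 fun x : En n => x - y := contDiff_id.sub contDiff_const
    have h1 : ContDiff ℝ 2 fun x : En n => ⟪q, x - y⟫ := contDiff_const.inner ℝ h0
    have h2 : ContDiff ℝ 2 fun x : En n => ⟪B (x - y), x - y⟫ := (B.contDiff.comp h0).inner ℝ h0
    fun_prop
  · fun_prop

theorem hasFDerivAt_paraboloid (x : En n) (s : ℝ) :
    HasFDerivAt (fun x => paraboloid y t q τ B C x s)
      (innerSL ℝ q + (1 / 2 : ℝ) • (innerSL ℝ (B (x - y)) + (innerSL ℝ (x - y)).comp B)) x := by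
  have h0 : HasFDerivAt (fun x : En n => x - y) (ContinuousLinearMap.id ℝ (En n)) x :=
    (hasFDerivAt_id x).sub_const y
  have h1 : HasFDerivAt (fun x : En n => ⟪q, x - y⟫) (innerSL ℝ q) x :=
    (innerSL ℝ q).hasFDerivAt.comp x h0
  have h2 := (B.hasFDerivAt.comp x h0).inner ℝ h0
  have h3 := ((h1.add_const (τ * (s - t))).add (h2.const_mul (1 / 2))).add_const (C * (s - t) ^ 2)
  refine h3.congr_fderiv ?_
  ext w
  simp [real_inner_comm, inner_sub_left, inner_sub_right]
  ring

theorem sgrad_paraboloid : sgrad (paraboloid y t q τ B C) y t = q := by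
  refine HasGradientAt.gradient ?_
  rw [hasGradientAt_iff_hasFDerivAt]
  refine (hasFDerivAt_paraboloid y t).congr_fderiv ?_
  ext w
  simp

theorem shess_paraboloid : shess (paraboloid y t q τ B C) y t = symMatrix B := by
  ext i j
  simp only [shess, symMatrix, Matrix.of_apply, (hasFDerivAt_paraboloid _ t).fderiv]
  set e := EuclideanSpace.single i (1 : ℝ)
  set e' := EuclideanSpace.single j (1 : ℝ)
  have h0 : HasFDerivAt (fun x : En n => x - y) (ContinuousLinearMap.id ℝ (En n)) y :=
    (hasFDerivAt_id y).sub_const y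
  have h1 : HasFDerivAt (fun x : En n => ⟪e', B (x - y)⟫) ((innerSL ℝ e').comp B) y :=
    ((innerSL ℝ e').comp B).hasFDerivAt.comp y h0
  have h2 : HasFDerivAt (fun x : En n => ⟪B e', x - y⟫) (innerSL ℝ (B e')) y :=
    (innerSL ℝ (B e')).hasFDerivAt.comp y h0
  have h3 := ((h1.add h2).const_mul (1 / 2)).const_add ⟪q, e'⟫
  have h4 : (fun x => (innerSL ℝ q + (1 / 2 : ℝ) •
      (innerSL ℝ (B (x - y)) + (innerSL ℝ (x - y)).comp B)) e') =
      fun x => ⟪q, e'⟫ + 1 / 2 * (⟪e', B (x - y)⟫ + ⟪B e', x - y⟫) := by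
    ext x
    simp [real_inner_comm, inner_sub_right]
    ring
  rw [h4]
  refine (congrArg (fun L : En n →L[ℝ] ℝ => L e) h3.fderiv).trans ?_
  simp [real_inner_comm]
  ring

theorem tpartial_paraboloid : tpartial (paraboloid y t q τ B C) y t = τ := by
  refine HasDerivAt.deriv ?_
  have h0 : HasDerivAt (fun s : ℝ => s - t) 1 t := (hasDerivAt_id t).sub_const t
  have h1 := ((h0.const_mul τ).const_add ⟪q, y - y⟫).add_const (1 / 2 * ⟪B (y - y), y - y⟫)
  refine (h1.add ((h0.pow 2).const_mul C)).congr_deriv ?_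
  simp

variable {T : ℝ} {Ω : Set (En n)} {F : ℝ → En n → Sym n → ℝ} {f : ℝ → ℝ} {u v : En n → ℝ → ℝ}

theorem continuousOn_operator
    (hFc : ContinuousOn (fun q : ℝ × En n × Sym n => F q.1 q.2.1 q.2.2)
      (Ioo 0 T ×ˢ (univ : Set (En n × Sym n)))) :
    ContinuousOn (fun z : ℝ × En n × (En n →L[ℝ] En n) =>
      F z.1 z.2.1 (symMatrix z.2.2 + vouter z.2.1 z.2.1))
      (Ioo 0 T ×ˢ (univ : Set (En n × (En n →L[ℝ] En n)))) := by
  have hv : Continuous fun z : ℝ × En n × (En n →L[ℝ] En n) => vouter z.2.1 z.2.1 := by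
    unfold vouter
    refine continuous_matrix fun i j => ?_
    simp only [Matrix.of_apply]
    fun_prop
  have hs : Continuous fun z : ℝ × En n × (En n →L[ℝ] En n) => symMatrix z.2.2 :=
    continuous_symMatrix.comp (by fun_prop)
  have hg : Continuous fun z : ℝ × En n × (En n →L[ℝ] En n) =>
      (z.1, z.2.1, symMatrix z.2.2 + vouter z.2.1 z.2.1) := by fun_prop
  exact hFc.comp hg.continuousOn fun z hz => ⟨hz.1, mem_univ _⟩

theorem tendsto_operator
    (hFc : ContinuousOn (fun q : ℝ × En n × Sym n => F q.1 q.2.1 q.2.2)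
      (Ioo 0 T ×ˢ (univ : Set (En n × Sym n)))) (ht : t ∈ Ioo 0 T) :
    Tendsto (fun η : ℝ => F t q (symMatrix (B + η • ContinuousLinearMap.id ℝ (En n)) + vouter q q))
      (𝓝 0) (𝓝 (F t q (symMatrix B + vouter q q))) := by
  have h1 := ((continuousOn_operator hFc).continuousAt (x := (t, q, B))
    (prod_mem_nhds (Ioo_mem_nhds ht.1 ht.2) univ_mem)).tendsto
  have h2 : Continuous fun η : ℝ => (t, q, B + η • ContinuousLinearMap.id ℝ (En n)) := by fun_prop
  refine h1.comp (h2.tendsto' 0 _ ?_)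
  have h3 : (0 : ℝ) • ContinuousLinearMap.id ℝ (En n) = 0 := by ext w; simp
  rw [h3, add_zero]

theorem ParSubF.le_of_expansion (hsub : ParSubF F f (pcyl Ω T) u)
    (hFc : ContinuousOn (fun q : ℝ × En n × Sym n => F q.1 q.2.1 q.2.2)
      (Ioo 0 T ×ˢ (univ : Set (En n × Sym n)))) (hy : (y, t) ∈ pcyl Ω T)
    (hexp : ∀ η > 0, ∃ C : ℝ, ∀ᶠ z in 𝓝[pcyl Ω T] (y, t), u z.1 z.2 ≤ u y t + ⟪q, z.1 - y⟫ +
      τ * (z.2 - t) + 1 / 2 * ⟪B (z.1 - y), z.1 - y⟫ + η * ‖z.1 - y‖ ^ 2 + C * (z.2 - t) ^ 2) :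
    0 ≤ F t q (symMatrix B + vouter q q) - f t * τ := by
  refine ge_of_tendsto
    (((tendsto_operator hFc hy.2).mono_left (nhdsWithin_le_nhds (s := Ioi 0))).sub_const
      (f t * τ)) ?_
  filter_upwards [self_mem_nhdsWithin] with η hη
  obtain ⟨C, hC⟩ := hexp (η / 2) (half_pos hη)
  have h := hsub (paraboloid y t q τ (B + η • ContinuousLinearMap.id ℝ (En n)) C)
    isTestFn_paraboloid y t hy ?_
  · rwa [sgrad_paraboloid, shess_paraboloid, tpartial_paraboloid] at h
  · filter_upwards [hC] with z hz
    simp only [paraboloid, add_apply, smul_apply,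
      ContinuousLinearMap.id_apply, inner_add_left, inner_smul_left, real_inner_self_eq_norm_sq,
      RCLike.conj_to_real, sub_self, inner_zero_right]
    linarith

theorem ParSuperF.le_of_expansion (hsuper : ParSuperF F f (pcyl Ω T) v)
    (hFc : ContinuousOn (fun q : ℝ × En n × Sym n => F q.1 q.2.1 q.2.2)
      (Ioo 0 T ×ˢ (univ : Set (En n × Sym n)))) (hy : (y, t) ∈ pcyl Ω T)
    (hexp : ∀ η > 0, ∃ C : ℝ, ∀ᶠ z in 𝓝[pcyl Ω T] (y, t), v y t + ⟪q, z.1 - y⟫ +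
      τ * (z.2 - t) + 1 / 2 * ⟪B (z.1 - y), z.1 - y⟫ - η * ‖z.1 - y‖ ^ 2 - C * (z.2 - t) ^ 2
      ≤ v z.1 z.2) :
    F t q (symMatrix B + vouter q q) - f t * τ ≤ 0 := by
  refine le_of_tendsto
    (((tendsto_operator hFc hy.2).mono_left (nhdsWithin_le_nhds (s := Iio 0))).sub_const
      (f t * τ)) ?_
  filter_upwards [self_mem_nhdsWithin] with η hη
  obtain ⟨C, hC⟩ := hexp (-η / 2) (half_pos (neg_pos.2 hη))
  have h := hsuper (paraboloid y t q τ (B + η • ContinuousLinearMap.id ℝ (En n)) (-C))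
    isTestFn_paraboloid y t hy ?_
  · rwa [sgrad_paraboloid, shess_paraboloid, tpartial_paraboloid] at h
  · filter_upwards [hC] with z hz
    simp only [paraboloid, add_apply, smul_apply,
      ContinuousLinearMap.id_apply, inner_add_left, inner_smul_left, real_inner_self_eq_norm_sq,
      RCLike.conj_to_real, sub_self, inner_zero_right]
    linarith

end TestFunctions

section Anisotropic

open scoped Topology RealInnerProductSpace

variable {H : Type*} [NormedAddCommGroup H] [InnerProductSpace ℝ H]

theorem abs_inner_add_sub_inner_le (A : H →L[ℝ] H) (x y : H) :
    |⟪A (x + y), x + y⟫ - ⟪A x, x⟫| ≤ ‖A‖ * (2 * ‖x‖ * ‖y‖ + ‖y‖ ^ 2) := by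
  have key : ∀ a b : H, |⟪A a, b⟫| ≤ ‖A‖ * (‖a‖ * ‖b‖) := fun a b =>
    calc |⟪A a, b⟫| ≤ ‖A a‖ * ‖b‖ := abs_real_inner_le_norm _ _
      _ ≤ ‖A‖ * ‖a‖ * ‖b‖ := by gcongr; exact A.le_opNorm a
      _ = ‖A‖ * (‖a‖ * ‖b‖) := by ring
  have h1 : ⟪A (x + y), x + y⟫ - ⟪A x, x⟫ = ⟪A x, y⟫ + ⟪A y, x⟫ + ⟪A y, y⟫ := by
    rw [map_add, inner_add_left, inner_add_right, inner_add_right]; ring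
  rw [h1]
  have h2 := abs_le.1 (key x y)
  have h3 := abs_le.1 (key y x)
  have h4 := abs_le.1 (key y y)
  rw [abs_le]
  constructor <;> nlinarith

/-- Along a splitting of the increment, the quadratic form of `A` only depends on the first
component, up to an arbitrarily small multiple of its square and a multiple of the square of the
second component. -/
theorem abs_inner_add_sub_inner_le_of_norm_le {A : H →L[ℝ] H} (hA : ‖A‖ ≤ 3) {η : ℝ} (hη : 0 < η)
    (x y : H) :
    |⟪A (x + y), x + y⟫ - ⟪A x, x⟫| ≤ η * ‖x‖ ^ 2 + (9 / η + 3) * ‖y‖ ^ 2 := by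
  refine (abs_inner_add_sub_inner_le A x y).trans ?_
  have h1 : ‖A‖ * (2 * ‖x‖ * ‖y‖ + ‖y‖ ^ 2) ≤ 3 * (2 * ‖x‖ * ‖y‖ + ‖y‖ ^ 2) := by gcongr
  have h2 : η * ‖x‖ ^ 2 + (9 / η + 3) * ‖y‖ ^ 2 - 3 * (2 * ‖x‖ * ‖y‖ + ‖y‖ ^ 2) =
      (η * ‖x‖ - 3 * ‖y‖) ^ 2 / η := by field_simp; ring
  have h3 : 0 ≤ (η * ‖x‖ - 3 * ‖y‖) ^ 2 / η := by positivity
  linarith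

variable {E : Type*} [NormedAddCommGroup E] [InnerProductSpace ℝ E]

/-- Anisotropic rescaling of space and time. -/
def rescale (α β : ℝ) (z : E × ℝ) : WithLp 2 (E × ℝ) := WithLp.toLp 2 (α⁻¹ • z.1, β⁻¹ * z.2)

variable {α β : ℝ}

theorem rescale_add (z w : E × ℝ) : rescale α β (z + w) = rescale α β z + rescale α β w := by
  simp only [rescale, Prod.fst_add, Prod.snd_add, smul_add, mul_add]; rfl

theorem rescale_sub (z w : E × ℝ) : rescale α β (z - w) = rescale α β z - rescale α β w := by
  simp only [rescale, Prod.fst_sub, Prod.snd_sub, smul_sub, mul_sub]; rfl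

theorem inner_rescale (p : WithLp 2 (E × ℝ)) (z : E × ℝ) :
    ⟪p, rescale α β z⟫ = ⟪α⁻¹ • p.fst, z.1⟫ + β⁻¹ * p.snd * z.2 := by
  simp [rescale, WithLp.prod_inner_apply, inner_smul_left, inner_smul_right]; ring

theorem norm_rescale_sq (z : E × ℝ) :
    ‖rescale α β z‖ ^ 2 = ‖z.1‖ ^ 2 / α ^ 2 + z.2 ^ 2 / β ^ 2 := by
  rw [rescale, WithLp.prod_norm_sq_eq_of_L2]
  simp only [WithLp.toLp_fst, WithLp.toLp_snd, norm_smul, norm_mul, mul_pow, Real.norm_eq_abs,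
    sq_abs]
  ring

theorem continuous_rescale : Continuous (rescale α β : E × ℝ → WithLp 2 (E × ℝ)) :=
  (WithLp.prod_continuous_toLp 2 E ℝ).comp (by fun_prop)

theorem rescale_eq_add (z : E × ℝ) :
    rescale α β z = WithLp.toLp 2 (α⁻¹ • z.1, 0) + WithLp.toLp 2 (0, β⁻¹ * z.2) := by
  rw [← WithLp.toLp_add]; simp [rescale]

theorem exists_spatial_operator [FiniteDimensional ℝ E] (hα : 0 < α)
    {A : WithLp 2 (E × ℝ) →L[ℝ] WithLp 2 (E × ℝ)} (hA : ‖A‖ ≤ 3) :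
    ∃ B : E →L[ℝ] E, ‖B‖ ≤ 3 / α ^ 2 ∧ ∀ η > 0, ∃ C : ℝ, ∀ z : E × ℝ,
      |1 / 2 * ⟪A (rescale α β z), rescale α β z⟫ - 1 / 2 * ⟪B z.1, z.1⟫| +
        η * α ^ 2 / 2 * ‖rescale α β z‖ ^ 2 ≤ η * ‖z.1‖ ^ 2 + C * z.2 ^ 2 := by
  have := FiniteDimensional.complete ℝ E
  let j : E →ₗᵢ[ℝ] WithLp 2 (E × ℝ) :=
    { toFun := fun x => WithLp.toLp 2 (x, 0)
      map_add' := fun x y => by rw [← WithLp.toLp_add]; simp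
      map_smul' := fun c x => by rw [← WithLp.toLp_smul]; simp
      norm_map' := fun x => by simp }
  let J := j.toContinuousLinearMap
  have hJ : ‖J‖ ≤ 1 := j.norm_toContinuousLinearMap_le
  have hJ' : ‖J.adjoint‖ ≤ 1 := by simpa using hJ
  have hB : ∀ x : E, ⟪A (WithLp.toLp 2 (α⁻¹ • x, 0)), WithLp.toLp 2 (α⁻¹ • x, 0)⟫ =
      ⟪((α ^ 2)⁻¹ • (J.adjoint.comp (A.comp J))) x, x⟫ := by
    intro x
    have h1 : WithLp.toLp 2 (α⁻¹ • x, (0 : ℝ)) = α⁻¹ • J x := by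
      change _ = α⁻¹ • WithLp.toLp 2 (x, (0 : ℝ))
      rw [← WithLp.toLp_smul]; simp
    rw [h1]
    simp [inner_smul_left, inner_smul_right, ContinuousLinearMap.adjoint_inner_left]
    ring
  refine ⟨(α ^ 2)⁻¹ • (J.adjoint.comp (A.comp J)), ?_, fun η hη => ?_⟩
  · rw [norm_smul, norm_inv, norm_pow, Real.norm_eq_abs, sq_abs, div_eq_inv_mul]
    gcongr
    calc ‖J.adjoint.comp (A.comp J)‖ ≤ ‖J.adjoint‖ * (‖A‖ * ‖J‖) :=
          (ContinuousLinearMap.opNorm_comp_le _ _).trans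
            (by gcongr; exact ContinuousLinearMap.opNorm_comp_le _ _)
      _ ≤ 1 * (3 * 1) := by gcongr
      _ = 3 := by norm_num
  · have hη' : 0 < η * α ^ 2 := by positivity
    refine ⟨((9 / (η * α ^ 2) + 3) / 2 + η * α ^ 2 / 2) / β ^ 2, fun z => ?_⟩
    have h1 := abs_inner_add_sub_inner_le_of_norm_le hA hη'
      (WithLp.toLp 2 (α⁻¹ • z.1, (0 : ℝ))) (WithLp.toLp 2 ((0 : E), β⁻¹ * z.2))
    rw [← rescale_eq_add, hB] at h1
    rw [← mul_sub, abs_mul, norm_rescale_sq]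
    have h2 : ‖WithLp.toLp 2 (α⁻¹ • z.1, (0 : ℝ))‖ ^ 2 = ‖z.1‖ ^ 2 / α ^ 2 := by
      rw [WithLp.prod_norm_sq_eq_of_L2]; simp [norm_smul, mul_pow]; ring
    have h3 : ‖WithLp.toLp 2 ((0 : E), β⁻¹ * z.2)‖ ^ 2 = z.2 ^ 2 / β ^ 2 := by
      rw [WithLp.prod_norm_sq_eq_of_L2]; simp [mul_pow]; ring
    rw [h2, h3] at h1
    have h4 : η * α ^ 2 * (‖z.1‖ ^ 2 / α ^ 2) = η * ‖z.1‖ ^ 2 := by field_simp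
    have h5 : |(1 / 2 : ℝ)| = 1 / 2 := by norm_num
    have h6 : ((9 / (η * α ^ 2) + 3) / 2 + η * α ^ 2 / 2) / β ^ 2 * z.2 ^ 2 =
      1 / 2 * ((9 / (η * α ^ 2) + 3) * (z.2 ^ 2 / β ^ 2)) + η * α ^ 2 / 2 * (z.2 ^ 2 / β ^ 2) := by
      ring
    rw [h5, h6]
    linarith

theorem exists_second_order_contact_prod [FiniteDimensional ℝ E] {K : Set (E × ℝ)}
    (hK : IsCompact K) (hne : K.Nonempty) {u v : E × ℝ → ℝ} (hu : UpperSemicontinuousOn u K)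
    (hv : LowerSemicontinuousOn v K) (hα : 0 < α) (hβ : 0 < β) {r : ℝ} (hr : 0 < r) :
    ∃ (p a b : E × ℝ) (B : E →L[ℝ] E), ‖p.1‖ < r ∧ |p.2| < r ∧ a ∈ K ∧ b ∈ K ∧
      (∀ a' ∈ K, ∀ b' ∈ K,
        u a' - v b' - 1 / 4 * (‖a'.1 - b'.1‖ ^ 2 / α ^ 2 + (a'.2 - b'.2) ^ 2 / β ^ 2) -
          1 / 2 * (⟪p.1, a'.1 + b'.1⟫ + p.2 * (a'.2 + b'.2)) ≤
        u a - v b - 1 / 4 * (‖a.1 - b.1‖ ^ 2 / α ^ 2 + (a.2 - b.2) ^ 2 / β ^ 2) -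
          1 / 2 * (⟪p.1, a.1 + b.1⟫ + p.2 * (a.2 + b.2))) ∧
      ‖B‖ ≤ 3 / α ^ 2 ∧
      (∀ η > 0, ∃ C : ℝ, ∀ᶠ z in 𝓝[K] a, u z ≤ u a +
        ⟪(1 / (2 * α ^ 2)) • (a.1 - b.1) + (1 / 2 : ℝ) • p.1, z.1 - a.1⟫ +
        ((a.2 - b.2) / (2 * β ^ 2) + p.2 / 2) * (z.2 - a.2) +
        1 / 2 * ⟪B (z.1 - a.1), z.1 - a.1⟫ + η * ‖z.1 - a.1‖ ^ 2 + C * (z.2 - a.2) ^ 2) ∧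
      (∀ η > 0, ∃ C : ℝ, ∀ᶠ z in 𝓝[K] b, v b +
        ⟪(1 / (2 * α ^ 2)) • (a.1 - b.1) - (1 / 2 : ℝ) • p.1, z.1 - b.1⟫ +
        ((a.2 - b.2) / (2 * β ^ 2) - p.2 / 2) * (z.2 - b.2) +
        1 / 2 * ⟪B (z.1 - b.1), z.1 - b.1⟫ - η * ‖z.1 - b.1‖ ^ 2 - C * (z.2 - b.2) ^ 2 ≤ v z) := by
  let R : WithLp 2 (E × ℝ) → E × ℝ := fun h => (α • h.fst, β * h.snd)
  have hRS : ∀ z, R (rescale α β z) = z := fun z => by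
    simp [R, rescale, smul_smul, mul_inv_cancel₀ hα.ne', mul_inv_cancel_left₀ hβ.ne']
  have hRc : Continuous R := by
    have h1 : Continuous fun h : WithLp 2 (E × ℝ) => (WithLp.ofLp h) :=
      WithLp.prod_continuous_ofLp 2 E ℝ
    exact ((continuous_fst.comp h1).const_smul α).prodMk ((continuous_snd.comp h1).const_mul β)
  have hmaps : MapsTo R (rescale α β '' K) K := by
    rintro _ ⟨z, hz, rfl⟩
    rwa [hRS]
  obtain ⟨p, _, _, A, hp, ⟨a, ha, rfl⟩, ⟨b, hb, rfl⟩, hmax, hA, hua, hvb⟩ :=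
    exists_second_order_contact (hK.image continuous_rescale) (hne.image _)
      (hu.comp hRc.continuousOn hmaps) (hv.comp hRc.continuousOn hmaps)
      (mul_pos hr (lt_min hα hβ))
  obtain ⟨B, hBn, hB⟩ := exists_spatial_operator (β := β) hα hA
  have hev : ∀ a : E × ℝ, Tendsto (fun z => rescale α β (z - a)) (𝓝[K] a) (𝓝 0) := fun a => by
    have h1 : Continuous fun z => rescale α β (z - a) := continuous_rescale.comp (by fun_prop)
    exact (h1.tendsto' a 0 (by simp [rescale])).mono_left nhdsWithin_le_nhds
  have hp1 : ‖p.fst‖ < r * α := (WithLp.norm_fst_le E p).trans_lt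
    (hp.trans_le (by gcongr; exact min_le_left _ _))
  have hp2 : ‖p.snd‖ < r * β := (WithLp.norm_snd_le E p).trans_lt
    (hp.trans_le (by gcongr; exact min_le_right _ _))
  have hlin : ∀ z w : E × ℝ, ⟪rescale α β z, rescale α β w⟫ = ⟪(1 / α ^ 2) • z.1, w.1⟫ + z.2 / β ^ 2 * w.2 := by
    intro z w
    refine (inner_rescale _ _).trans ?_
    simp [rescale, inner_smul_left]
    ring
  refine ⟨(α⁻¹ • p.fst, β⁻¹ * p.snd), a, b, B, ?_, ?_, ha, hb, fun a' ha' b' hb' => ?_, hBn,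
    fun η hη => ?_, fun η hη => ?_⟩
  · rw [norm_smul, norm_inv, Real.norm_of_nonneg hα.le, inv_mul_lt_iff₀ hα]
    linarith
  · rw [abs_mul, abs_inv, abs_of_pos hβ, inv_mul_lt_iff₀ hβ, ← Real.norm_eq_abs]
    linarith
  · have h1 := hmax _ (mem_image_of_mem _ ha') _ (mem_image_of_mem _ hb')
    simp only [Function.comp_apply, hRS] at h1
    simp only [← rescale_sub, ← rescale_add, norm_rescale_sq, inner_rescale] at h1
    exact h1
  · obtain ⟨C, hC⟩ := hB η hη
    refine ⟨C, ?_⟩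
    filter_upwards [(hev a).eventually (hua (η * α ^ 2 / 2) (by positivity)),
      self_mem_nhdsWithin] with z hz hzK
    have h1 : rescale α β a + rescale α β (z - a) = rescale α β z := by simp [rescale_sub]
    rw [h1] at hz
    have h2 := hz (mem_image_of_mem _ hzK)
    simp only [Function.comp_apply, hRS] at h2
    rw [inner_add_left, ← rescale_sub, hlin,
      inner_rescale p] at h2
    have h3 := hC (z - a)
    have h4 := le_abs_self (1 / 2 * ⟪A (rescale α β (z - a)), rescale α β (z - a)⟫ -
      1 / 2 * ⟪B (z - a).1, (z - a).1⟫)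
    simp only [Prod.fst_sub, Prod.snd_sub, inner_add_left, inner_smul_left,
      RCLike.conj_to_real] at h2 h3 h4 ⊢
    have h5 : 1 / 2 * (1 / α ^ 2 * ⟪a.1 - b.1, z.1 - a.1⟫) =
      1 / (2 * α ^ 2) * ⟪a.1 - b.1, z.1 - a.1⟫ := by ring
    have h6 : 1 / 2 * ((a.2 - b.2) / β ^ 2 * (z.2 - a.2)) =
      (a.2 - b.2) / (2 * β ^ 2) * (z.2 - a.2) := by ring
    linarith
  · obtain ⟨C, hC⟩ := hB η hη
    refine ⟨C, ?_⟩
    filter_upwards [(hev b).eventually (hvb (η * α ^ 2 / 2) (by positivity)),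
      self_mem_nhdsWithin] with z hz hzK
    have h1 : rescale α β b + rescale α β (z - b) = rescale α β z := by simp [rescale_sub]
    rw [h1] at hz
    have h2 := hz (mem_image_of_mem _ hzK)
    simp only [Function.comp_apply, hRS] at h2
    rw [inner_sub_left, ← rescale_sub, hlin,
      inner_rescale p] at h2
    have h3 := hC (z - b)
    have h4 := neg_abs_le (1 / 2 * ⟪A (rescale α β (z - b)), rescale α β (z - b)⟫ -
      1 / 2 * ⟪B (z - b).1, (z - b).1⟫)
    simp only [Prod.fst_sub, Prod.snd_sub, inner_sub_left, inner_smul_left,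
      RCLike.conj_to_real] at h2 h3 h4 ⊢
    have h5 : 1 / 2 * (1 / α ^ 2 * (⟪a.1, z.1 - b.1⟫ - ⟪b.1, z.1 - b.1⟫)) =
      1 / (2 * α ^ 2) * (⟪a.1, z.1 - b.1⟫ - ⟪b.1, z.1 - b.1⟫) := by ring
    have h6 : 1 / 2 * ((a.2 - b.2) / β ^ 2 * (z.2 - b.2)) =
      (a.2 - b.2) / (2 * β ^ 2) * (z.2 - b.2) := by ring
    linarith

end Anisotropic

section Doubling

open scoped Topology RealInnerProductSpace

/-- If the diagonal points of a compact set have both coordinates in an open set `N`, then so do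
the points near the diagonal. -/
theorem exists_dist_lt_imp_mem_of_diagonal {X : Type*} [MetricSpace X] {S : Set (X × X)}
    (hS : IsCompact S) {N : Set X} (hN : IsOpen N) (hdiag : ∀ x, (x, x) ∈ S → x ∈ N) :
    ∃ ε > 0, ∀ a b, (a, b) ∈ S → dist a b < ε → a ∈ N ∧ b ∈ N := by
  have hC : IsCompact (S \ N ×ˢ N) := hS.diff (hN.prod hN)
  rcases (S \ N ×ˢ N).eq_empty_or_nonempty with he | hne
  · refine ⟨1, one_pos, fun a b hab _ => ?_⟩
    by_contra hcon
    exact (he ▸ notMem_empty (a, b)) ⟨hab, hcon⟩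
  · obtain ⟨⟨x, y⟩, hxy, hmin⟩ :=
      hC.exists_isMinOn hne (f := fun q : X × X => dist q.1 q.2) (by fun_prop)
    refine ⟨dist x y, dist_pos.2 fun h => ?_, fun a b hab hlt => ?_⟩
    · subst h
      exact hxy.2 ⟨hdiag _ hxy.1, hdiag _ hxy.1⟩
    · by_contra hcon
      exact absurd (hmin (a := (a, b)) ⟨hab, hcon⟩) (not_le.2 hlt)

theorem nonpos_of_approximate_gap {V W : Type*} [NormedAddCommGroup V] [NormedAddCommGroup W]
    [ProperSpace V] [ProperSpace W] {I J : Set ℝ} (hJ : IsCompact J) (hJI : J ⊆ I)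
    {G : ℝ × V × W → ℝ} (hG : ContinuousOn G (I ×ˢ univ)) {κ R : ℝ}
    (h : ∀ δ > 0, ∃ t ∈ J, ∃ s ∈ J, ∃ (q q' : V) (B : W), ‖q‖ ≤ R ∧ ‖B‖ ≤ R ∧ ‖q - q'‖ ≤ δ ∧
      |t - s| ≤ δ ∧ κ - δ ≤ G (t, q, B) - G (s, q', B)) : κ ≤ 0 := by
  by_contra! hκ
  have hC : IsCompact (J ×ˢ closedBall (0 : V) (R + 1) ×ˢ closedBall (0 : W) R) :=
    hJ.prod ((isCompact_closedBall _ _).prod (isCompact_closedBall _ _))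
  have huc := hC.uniformContinuousOn_of_continuous
    (hG.mono fun z hz => ⟨hJI hz.1, mem_univ _⟩)
  obtain ⟨δ, hδ, hu⟩ := Metric.uniformContinuousOn_iff.1 huc (κ / 2) (half_pos hκ)
  obtain ⟨t, ht, s, hs, q, q', B, hq, hB, hqq, hts, hgap⟩ :=
    h (min (min (δ / 2) 1) (κ / 2)) (by positivity)
  simp only [le_min_iff] at hqq hts
  have hδκ := min_le_right (min (δ / 2) 1) (κ / 2)
  have hq' : ‖q'‖ ≤ R + 1 := by
    have := norm_sub_norm_le q' q
    rw [norm_sub_rev] at this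
    linarith [hqq.1.2]
  have hlt := hu (t, q, B) ⟨ht, by simpa using hq.trans (by linarith), by simpa using hB⟩
    (s, q', B) ⟨hs, by simpa using hq', by simpa using hB⟩ (by
      rw [Prod.dist_eq, Prod.dist_eq, Real.dist_eq, dist_eq_norm q, dist_self]
      refine max_lt (by linarith [hts.1.1]) (max_lt (by linarith [hqq.1.1]) hδ))
  rw [Real.dist_eq] at hlt
  linarith [(abs_lt.1 hlt).2]

/-- Doubling of variables with independent penalization of space and time: near-maximum points
of `w a - v b` at which `w` and `v` admit matching second order expansions. -/
theorem exists_penalized_contact {E : Type*} [NormedAddCommGroup E] [InnerProductSpace ℝ E]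
    [FiniteDimensional ℝ E] {K : Set (E × ℝ)} (hK : IsCompact K) {w v : E × ℝ → ℝ}
    (hw : UpperSemicontinuousOn w K) (hv : LowerSemicontinuousOn v K) {z₀ : E × ℝ} (hz₀ : z₀ ∈ K)
    {m : ℝ} (hm : 0 < m) (hz₀m : 2 * m ≤ w z₀ - v z₀) {ε : ℝ} (hε : 0 < ε) :
    ∃ R : ℝ, ∀ δ > 0, ∃ a ∈ K, ∃ b ∈ K, m ≤ w a - v b ∧ dist a b ≤ ε ∧ |a.2 - b.2| ≤ δ ∧
      ∃ (q q' : E) (τ τ' : ℝ) (B : E →L[ℝ] E), ‖q‖ ≤ R ∧ ‖B‖ ≤ R ∧ ‖q - q'‖ ≤ δ ∧ τ' - δ ≤ τ ∧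
      (∀ η > 0, ∃ C : ℝ, ∀ᶠ z in 𝓝[K] a, w z ≤ w a + ⟪q, z.1 - a.1⟫ + τ * (z.2 - a.2) +
        1 / 2 * ⟪B (z.1 - a.1), z.1 - a.1⟫ + η * ‖z.1 - a.1‖ ^ 2 + C * (z.2 - a.2) ^ 2) ∧
      (∀ η > 0, ∃ C : ℝ, ∀ᶠ z in 𝓝[K] b, v b + ⟪q', z.1 - b.1⟫ + τ' * (z.2 - b.2) +
        1 / 2 * ⟪B (z.1 - b.1), z.1 - b.1⟫ - η * ‖z.1 - b.1‖ ^ 2 - C * (z.2 - b.2) ^ 2 ≤ v z) := by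
  have hne : K.Nonempty := ⟨z₀, hz₀⟩
  obtain ⟨q₀, -, hq₀⟩ := (upperSemicontinuousOn_prod_sub hw hv).exists_isMaxOn (hne.prod hne)
    (hK.prod hK)
  set A := w q₀.1 - v q₀.2
  have hA : ∀ a ∈ K, ∀ b ∈ K, w a - v b ≤ A := fun a ha b hb => hq₀ (mk_mem_prod ha hb)
  have hA0 : 0 < A := by linarith [hA z₀ hz₀ z₀ hz₀]
  obtain ⟨ρ, hρ, hKρ⟩ := hK.isBounded.exists_pos_norm_le
  have hbound : ∀ θ > 0, ∀ x : ℝ, 0 ≤ x → x ^ 2 / (θ / (A + 1)) ^ 2 ≤ 4 * A → x ≤ θ := by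
    intro θ hθ x hx h
    rw [div_le_iff₀ (by positivity), div_pow, ← mul_div_assoc, le_div_iff₀ (by positivity)] at h
    have h1 : 4 * A ≤ (A + 1) ^ 2 := by nlinarith [sq_nonneg (A - 1)]
    have h2 : x ^ 2 * (A + 1) ^ 2 ≤ θ ^ 2 * (A + 1) ^ 2 := by nlinarith [sq_nonneg θ]
    have h3 : x ^ 2 ≤ θ ^ 2 := le_of_mul_le_mul_right h2 (by positivity)
    exact (sq_le_sq₀ hx hθ.le).1 h3
  set α := ε / (A + 1) with hαdef
  have hα : 0 < α := by positivity
  refine ⟨1 / (2 * α ^ 2) * ε + 1 + 3 / α ^ 2, fun δ hδ => ?_⟩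
  set r := min (min δ 1) (m / (4 * ρ))
  have hr : 0 < r := by positivity
  have hrδ : r ≤ δ := (min_le_left _ _).trans (min_le_left _ _)
  have hr1 : r ≤ 1 := (min_le_left _ _).trans (min_le_right _ _)
  have hrm : r * ρ ≤ m / 4 := by
    have h1 : r * ρ ≤ m / (4 * ρ) * ρ := by gcongr; exact min_le_right _ _
    have h2 : m / (4 * ρ) * ρ = m / 4 := by field_simp
    linarith
  obtain ⟨p, a, b, B, hp1, hp2, ha, hb, hmax, hB, hwa, hvb⟩ :=
    exists_second_order_contact_prod hK hne hw hv hα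
      (β := min ε δ / (A + 1)) (by positivity) hr
  have hlin : ∀ a ∈ K, ∀ b ∈ K,
      |1 / 2 * (⟪p.1, a.1 + b.1⟫ + p.2 * (a.2 + b.2))| ≤ m / 2 := by
    intro a ha b hb
    have h1 : ‖a.1 + b.1‖ ≤ 2 * ρ := by
      linarith [norm_add_le a.1 b.1, norm_fst_le a, norm_fst_le b, hKρ a ha, hKρ b hb]
    have h2 : |a.2 + b.2| ≤ 2 * ρ := by
      rw [← Real.norm_eq_abs]
      linarith [norm_add_le a.2 b.2, norm_snd_le a, norm_snd_le b, hKρ a ha, hKρ b hb]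
    have h3 : |⟪p.1, a.1 + b.1⟫| ≤ r * (2 * ρ) :=
      (abs_real_inner_le_norm _ _).trans (by gcongr)
    have h4 : |p.2 * (a.2 + b.2)| ≤ r * (2 * ρ) := by rw [abs_mul]; gcongr
    rw [abs_mul, abs_of_pos (by norm_num : (0 : ℝ) < 1 / 2)]
    linarith [abs_add_le ⟪p.1, a.1 + b.1⟫ (p.2 * (a.2 + b.2))]
  have h1 := hmax z₀ hz₀ z₀ hz₀
  have h2 := (abs_le.1 (hlin z₀ hz₀ z₀ hz₀)).2
  have h3 := (abs_le.1 (hlin a ha b hb)).1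
  have h4 := hA a ha b hb
  simp only [sub_self, norm_zero, ne_eq, OfNat.ofNat_ne_zero, not_false_eq_true, zero_pow,
    zero_div, add_zero, mul_zero, sub_zero] at h1
  have h5 : 0 ≤ ‖a.1 - b.1‖ ^ 2 / α ^ 2 := by positivity
  have h6 : 0 ≤ (a.2 - b.2) ^ 2 / (min ε δ / (A + 1)) ^ 2 := by positivity
  have hx : ‖a.1 - b.1‖ ≤ ε := hbound ε hε _ (norm_nonneg _) (by linarith)
  have ht : |a.2 - b.2| ≤ min ε δ :=
    hbound _ (lt_min hε hδ) _ (abs_nonneg _) (by rw [sq_abs]; linarith)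
  refine ⟨a, ha, b, hb, by linarith, ?_, ht.trans (min_le_right _ _), _, _, _, _, B, ?_, ?_, ?_, ?_,
    hwa, hvb⟩
  · rw [Prod.dist_eq, dist_eq_norm, Real.dist_eq]
    exact max_le hx (ht.trans (min_le_left _ _))
  · have h7 : ‖(1 / (2 * α ^ 2)) • (a.1 - b.1)‖ ≤ 1 / (2 * α ^ 2) * ε := by
      rw [norm_smul, Real.norm_of_nonneg (by positivity)]; gcongr
    have h8 : ‖(1 / 2 : ℝ) • p.1‖ ≤ 1 := by
      rw [norm_smul, Real.norm_of_nonneg (by norm_num)]; linarith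
    have h9 : 0 ≤ 3 / α ^ 2 := by positivity
    linarith [norm_add_le ((1 / (2 * α ^ 2)) • (a.1 - b.1)) ((1 / 2 : ℝ) • p.1)]
  · have h9 : 0 ≤ 1 / (2 * α ^ 2) * ε := by positivity
    linarith
  · rw [add_sub_sub_cancel, ← add_smul]
    norm_num
    linarith
  · linarith [(abs_lt.1 hp2).1]

end Doubling

section Comparison

open scoped Topology RealInnerProductSpace

variable {n : ℕ} {Ω : Set (En n)} {T : ℝ} {F : ℝ → En n → Sym n → ℝ} {f : ℝ → ℝ}
  {u v : En n → ℝ → ℝ}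

theorem mem_pcyl_union_pbdry (hΩo : IsOpen Ω) {z : En n × ℝ} (hz1 : z.1 ∈ closure Ω)
    (hz2 : z.2 ∈ Ico 0 T) : z ∈ pcyl Ω T ∪ pbdry Ω T := by
  rcases hz2.1.eq_or_lt with h0 | h0
  · exact Or.inr (Or.inl ⟨hz1, h0.symm⟩)
  · by_cases hx : z.1 ∈ Ω
    · exact Or.inl ⟨hx, h0, hz2.2⟩
    · exact Or.inr (Or.inr ⟨by rw [hΩo.frontier_eq]; exact ⟨hz1, hx⟩, hz2⟩)

/-- A quadratic bound in time for the barrier used to penalize the final time. -/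
theorem barrier_le {c e T' s t : ℝ} (hc : 0 < c) (he : 0 < e) (hs : e ≤ T' - s)
    (ht : e ≤ T' - t) :
    c / (T' - s) ≤ c / (T' - t) + c / (T' - t) ^ 2 * (s - t) + c / e ^ 3 * (s - t) ^ 2 := by
  have hs0 : 0 < T' - s := he.trans_le hs
  have ht0 : 0 < T' - t := he.trans_le ht
  have h1 : c / (T' - s) = c / (T' - t) + c / (T' - t) ^ 2 * (s - t) +
      c / ((T' - t) ^ 2 * (T' - s)) * (s - t) ^ 2 := by
    field_simp; ring
  have h2 : e ^ 3 ≤ (T' - t) ^ 2 * (T' - s) := by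
    rw [pow_succ]; gcongr
  rw [h1]
  gcongr

theorem ParSubF.le_of_penalized_expansion (hsub : ParSubF F f (pcyl Ω T) u)
    (hFc : ContinuousOn (fun q : ℝ × En n × Sym n => F q.1 q.2.1 q.2.2)
      (Ioo 0 T ×ˢ (univ : Set (En n × Sym n)))) {K : Set (En n × ℝ)} {a : En n × ℝ}
    (ha : a ∈ pcyl Ω T) (hK : K ∈ 𝓝 a) {c e T' : ℝ} (hc : 0 < c) (he : 0 < e)
    (hKe : ∀ z ∈ K, e ≤ T' - z.2) {q : En n} {τ : ℝ} {B : En n →L[ℝ] En n}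
    (hexp : ∀ η > 0, ∃ C : ℝ, ∀ᶠ z in 𝓝[K] a, u z.1 z.2 - c / (T' - z.2) ≤
      u a.1 a.2 - c / (T' - a.2) + ⟪q, z.1 - a.1⟫ + τ * (z.2 - a.2) +
        1 / 2 * ⟪B (z.1 - a.1), z.1 - a.1⟫ + η * ‖z.1 - a.1‖ ^ 2 + C * (z.2 - a.2) ^ 2) :
    0 ≤ F a.2 q (symMatrix B + vouter q q) - f a.2 * (τ + c / (T' - a.2) ^ 2) := by
  refine hsub.le_of_expansion hFc ha fun η hη => ?_
  obtain ⟨C, hC⟩ := hexp η hη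
  rw [nhdsWithin_eq_nhds.2 hK] at hC
  refine ⟨C + c / e ^ 3, ?_⟩
  filter_upwards [mem_nhdsWithin_of_mem_nhds hC, mem_nhdsWithin_of_mem_nhds hK] with z hz hzK
  have hz' : u z.1 z.2 - c / (T' - z.2) ≤
      u a.1 a.2 - c / (T' - a.2) + ⟪q, z.1 - a.1⟫ + τ * (z.2 - a.2) +
        1 / 2 * ⟪B (z.1 - a.1), z.1 - a.1⟫ + η * ‖z.1 - a.1‖ ^ 2 + C * (z.2 - a.2) ^ 2 := hz
  have h1 := barrier_le hc he (hKe z hzK) (hKe a (mem_of_mem_nhds hK))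
  linarith

/-- The penalized difference of a subsolution and a supersolution on a compact set `K` stays below
`2 * m` when its values of size at least `m` are attained inside the cylinder. -/
theorem ParSubF.penalized_sub_lt (hsub : ParSubF F f (pcyl Ω T) u)
    (hsuper : ParSuperF F f (pcyl Ω T) v)
    (hFc : ContinuousOn (fun q : ℝ × En n × Sym n => F q.1 q.2.1 q.2.2)
      (Ioo 0 T ×ˢ (univ : Set (En n × Sym n))))
    (hfc : ContinuousOn f (Ioo 0 T)) (hfpos : ∀ t ∈ Ioo 0 T, 0 < f t)
    {K N : Set (En n × ℝ)} (hK : IsCompact K) (hN : IsOpen N) (hNK : N ⊆ K) (hNQ : N ⊆ pcyl Ω T)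
    (husc : UpperSemicontinuousOn (fun q : En n × ℝ => u q.1 q.2) K)
    (hlsc : LowerSemicontinuousOn (fun q : En n × ℝ => v q.1 q.2) K)
    {c e T' m : ℝ} (hc : 0 < c) (he : 0 < e) (hm : 0 < m) (hKe : ∀ z ∈ K, e ≤ T' - z.2)
    (hK0 : ∀ z ∈ K, 0 ≤ z.2)
    (hdiag : ∀ z ∈ K, m ≤ u z.1 z.2 - c / (T' - z.2) - v z.1 z.2 → z ∈ N) {z₀ : En n × ℝ}
    (hz₀ : z₀ ∈ K) : u z₀.1 z₀.2 - c / (T' - z₀.2) - v z₀.1 z₀.2 < 2 * m := by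
  by_contra! hcon
  set w : En n × ℝ → ℝ := fun z => u z.1 z.2 - c / (T' - z.2) with hwdef
  have hw : UpperSemicontinuousOn w K := by
    have h1 : ContinuousOn (fun z : En n × ℝ => -(c / (T' - z.2))) K :=
      (continuousOn_const.div (by fun_prop) fun z hz => (he.trans_le (hKe z hz)).ne').neg
    simpa only [hwdef, sub_eq_add_neg] using husc.add h1.upperSemicontinuousOn
  set S := (K ×ˢ K) ∩ (fun q : (En n × ℝ) × (En n × ℝ) => w q.1 - v q.2.1 q.2.2) ⁻¹' Ici m
  have hS : IsCompact S :=
    (upperSemicontinuousOn_prod_sub hw hlsc).isCompact_inter_preimage_Ici (hK.prod hK) m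
  obtain ⟨ε, hε, hεN⟩ := exists_dist_lt_imp_mem_of_diagonal hS hN fun z hz =>
    hdiag z hz.1.1 hz.2
  set S' := S ∩ {q | dist q.1 q.2 ≤ ε / 2}
  have hS' : IsCompact S' := hS.inter_right (isClosed_le (by fun_prop) continuous_const)
  have hS'N : ∀ q ∈ S', q.1 ∈ N ∧ q.2 ∈ N := fun q hq =>
    hεN q.1 q.2 hq.1 (lt_of_le_of_lt hq.2 (half_lt_self hε))
  set J : Set ℝ := (fun q => q.1.2) '' S' ∪ (fun q => q.2.2) '' S'
  have hJ : IsCompact J := (hS'.image (by fun_prop)).union (hS'.image (by fun_prop))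
  have hJI : J ⊆ Ioo 0 T := by
    rintro _ (⟨q, hq, rfl⟩ | ⟨q, hq, rfl⟩)
    · exact (hNQ (hS'N q hq).1).2
    · exact (hNQ (hS'N q hq).2).2
  have hG : ContinuousOn (fun z : ℝ × En n × (En n →L[ℝ] En n) =>
      F z.1 z.2.1 (symMatrix z.2.2 + vouter z.2.1 z.2.1) / f z.1) (Ioo 0 T ×ˢ univ) :=
    (continuousOn_operator hFc).div
      (hfc.comp continuous_fst.continuousOn fun z hz => hz.1) fun z hz => (hfpos _ hz.1).ne'
  obtain ⟨R, hR⟩ := exists_penalized_contact hK hw hlsc hz₀ hm hcon (half_pos hε)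
  have hT' : 0 < T' := by linarith [hKe z₀ hz₀, hK0 z₀ hz₀]
  refine absurd (nonpos_of_approximate_gap hJ hJI hG (κ := c / T' ^ 2) (R := R) fun δ hδ => ?_)
    (not_le.2 (by positivity))
  obtain ⟨a, ha, b, hb, hab, hdist, htime, q, q', τ, τ', B, hq, hB, hqq, hττ, hua, hvb⟩ := hR δ hδ
  have hmem : (a, b) ∈ S' := ⟨⟨⟨ha, hb⟩, hab⟩, hdist⟩
  obtain ⟨haN, hbN⟩ := hS'N _ hmem
  refine ⟨a.2, Or.inl ⟨_, hmem, rfl⟩, b.2, Or.inr ⟨_, hmem, rfl⟩, q, q', B, hq, hB, hqq, htime, ?_⟩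
  have h1 := hsub.le_of_penalized_expansion hFc (hNQ haN)
    (mem_of_superset (hN.mem_nhds haN) hNK) hc he hKe hua
  have hbK : K ∈ 𝓝 b := mem_of_superset (hN.mem_nhds hbN) hNK
  have h2 := hsuper.le_of_expansion hFc (hNQ hbN) fun η hη => by
    obtain ⟨C, hC⟩ := hvb η hη
    rw [nhdsWithin_eq_nhds.2 hbK] at hC
    exact ⟨C, mem_nhdsWithin_of_mem_nhds hC⟩
  have h3 : τ + c / (T' - a.2) ^ 2 ≤ F a.2 q (symMatrix B + vouter q q) / f a.2 := by
    rw [le_div_iff₀ (hfpos _ (hNQ haN).2)]; linarith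
  have h4 : F b.2 q' (symMatrix B + vouter q' q') / f b.2 ≤ τ' := by
    rw [div_le_iff₀ (hfpos _ (hNQ hbN).2)]; linarith
  have h5 : c / T' ^ 2 ≤ c / (T' - a.2) ^ 2 := by
    have h6 := he.trans_le (hKe a ha)
    have h7 : (T' - a.2) ^ 2 ≤ T' ^ 2 := by
      gcongr
      linarith [hK0 a ha]
    gcongr
  simp only
  linarith

end Comparison

/-- comparison principle for F(t,Du,D²u + Du⊗Du) − f(t)u_t = 0. -/
theorem comparison_principle_F
    {n : ℕ} (hn : 2 ≤ n)
    (Ω : Set (En n)) (hΩo : IsOpen Ω) (hΩc : IsConnected Ω)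
    (hΩb : Bornology.IsBounded Ω)
    (T : ℝ) (hT : 0 < T)
    (F : ℝ → En n → Sym n → ℝ)
    (hFc : ContinuousOn (fun q : ℝ × En n × Sym n => F q.1 q.2.1 q.2.2)
      (Ioo 0 T ×ˢ (univ : Set (En n × Sym n))))
    (hFmono : ∀ t ∈ Ioo (0:ℝ) T, ∀ (p : En n) (X Y : Sym n),
      LoewnerLE X Y → F t p X ≤ F t p Y)
    (f : ℝ → ℝ) (hfc : ContinuousOn f (Ioo 0 T))
    (hfmaps : MapsTo f (Ioo 0 T) (Ioo 0 T))
    (u v : En n → ℝ → ℝ)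
    (husc : UpperSemicontinuousOn (fun q : En n × ℝ => u q.1 q.2) (pcyl Ω T ∪ pbdry Ω T))
    (hlsc : LowerSemicontinuousOn (fun q : En n × ℝ => v q.1 q.2) (pcyl Ω T ∪ pbdry Ω T))
    (hsub : ParSubF F f (pcyl Ω T) u)
    (hsuper : ParSuperF F f (pcyl Ω T) v)
    (hvbdd : BddAbove ((fun q : En n × ℝ => v q.1 q.2) '' pbdry Ω T))
    (hbc : ∀ q ∈ pbdry Ω T, u q.1 q.2 ≤ v q.1 q.2) :
    ∀ q ∈ pcyl Ω T, u q.1 q.2 ≤ v q.1 q.2 := by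
  by_contra! hcon
  obtain ⟨⟨x₀, t₀⟩, hz₀, hlt⟩ := hcon
  have ht₀ : t₀ ∈ Ioo 0 T := hz₀.2
  set d := u x₀ t₀ - v x₀ t₀ with hd
  have hd0 : 0 < d := sub_pos.2 hlt
  obtain ⟨T', ht₀T', hT'T⟩ := exists_between ht₀.2
  have hcomp : ∀ t < T, IsCompact (closure Ω ×ˢ Icc 0 t) ∧
      closure Ω ×ˢ Icc 0 t ⊆ pcyl Ω T ∪ pbdry Ω T := fun t ht =>
    ⟨hΩb.isCompact_closure.prod isCompact_Icc, fun z hz =>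
      mem_pcyl_union_pbdry hΩo hz.1 ⟨hz.2.1, hz.2.2.trans_lt ht⟩⟩
  obtain ⟨hK', hK'Q⟩ := hcomp T' hT'T
  have hz₀K' : (x₀, t₀) ∈ closure Ω ×ˢ Icc 0 T' := ⟨subset_closure hz₀.1, ht₀.1.le, ht₀T'.le⟩
  have hne : (closure Ω ×ˢ Icc 0 T').Nonempty := ⟨_, hz₀K'⟩
  obtain ⟨⟨a, b⟩, -, hmax⟩ := (upperSemicontinuousOn_prod_sub (husc.mono hK'Q)
    (hlsc.mono hK'Q)).exists_isMaxOn (hne.prod hne) (hK'.prod hK')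
  set D := u a.1 a.2 - v b.1 b.2
  have hD : ∀ z ∈ closure Ω ×ˢ Icc 0 T', u z.1 z.2 - v z.1 z.2 ≤ D := fun z hz =>
    hmax (mk_mem_prod hz hz)
  have hdD : d ≤ D := hD _ hz₀K'
  have hgap : 0 < T' - t₀ := sub_pos.2 ht₀T'
  set c := d * (T' - t₀) / 2 with hcdef
  have hc : 0 < c := by positivity
  set e := c / (D + 1) with hedef
  have hD1 : 0 < D + 1 := by linarith
  have he : 0 < e := by positivity
  have het₀ : e < T' - t₀ := by
    rw [hedef, div_lt_iff₀ hD1, hcdef]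
    nlinarith
  obtain ⟨hK, hKQ⟩ := hcomp (T' - e) (by linarith)
  have hz₀K : (x₀, t₀) ∈ closure Ω ×ˢ Icc 0 (T' - e) :=
    ⟨subset_closure hz₀.1, ht₀.1.le, by linarith⟩
  have hKK' : closure Ω ×ˢ Icc 0 (T' - e) ⊆ closure Ω ×ˢ Icc 0 T' :=
    prod_mono_right (Icc_subset_Icc_right (by linarith))
  have hmain := hsub.penalized_sub_lt hsuper hFc hfc (fun t ht => (hfmaps ht).1) hK
    (N := Ω ×ˢ Ioo 0 (T' - e)) (hΩo.prod isOpen_Ioo)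
    (prod_mono subset_closure Ioo_subset_Icc_self)
    (prod_mono_right (Ioo_subset_Ioo_right (by linarith))) (husc.mono hKQ) (hlsc.mono hKQ)
    (T' := T') (m := d / 4) hc he (by positivity) (fun z hz => by linarith [hz.2.2])
    (fun z hz => hz.2.1) (fun z hz hm => ?_) (z₀ := (x₀, t₀)) hz₀K
  · have h1 : c / (T' - t₀) = d / 2 := by rw [hcdef]; field_simp
    simp only [h1] at hmain
    linarith
  · have hze : e ≤ T' - z.2 := by linarith [hz.2.2]
    have hpos : 0 < c / (T' - z.2) := div_pos hc (he.trans_le hze)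
    have hnot : z ∉ pbdry Ω T := fun hzb => by linarith [hbc z hzb]
    have hzQ : z ∈ pcyl Ω T := (hKQ hz).resolve_right hnot
    refine ⟨hzQ.1, hzQ.2.1, lt_of_le_of_ne hz.2.2 fun hlid => ?_⟩
    have h1 : c / (T' - z.2) = D + 1 := by
      rw [hlid, sub_sub_cancel, hedef]
      field_simp
    linarith [hD z (hKK' hz)]

end DNLP
end
end

section
/- Let n ≥ 2, let Ω ⊂ ℝ^n be a bounded domain, 0 < T ≤ ∞, and let H satisfy Conditions A and B with homogeneity exponent k = k₁ + 1 ≥ 1. If u is upper semicontinuous on Ω_T with u > 0 and is a viscosity subsolution of H(Du,D²u) − u^{k−1}u_t = 0 in Ω_T, then w = log u is upper semicontinuous and is a viscosity subsolution of H(Dw, D²w + Dw⊗Dw) − w_t = 0 in Ω_T. Similarly, if u is lower semicontinuous with u > 0 and a viscosity supersolution of H(Du,D²u) − u^{k−1}u_t = 0 in Ω_T, then w = log u is a viscosity supersolution of H(Dw, D²w + Dw⊗Dw) − w_t = 0 in Ω_T. -/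
open Set Filter Metric

noncomputable section

namespace DNLP

variable {n : ℕ}

/-- Gradient of `exp (f + c)`. -/
theorem gradient_exp_add_const {f : En n → ℝ} {y : En n} (hf : DifferentiableAt ℝ f y) (c : ℝ) :
    gradient (fun x => Real.exp (f x + c)) y = Real.exp (f y + c) • gradient f y := by
  unfold gradient
  rw [((hf.hasFDerivAt.add_const c).exp).fderiv, map_smul]

theorem gradient_apply_eq_fderiv_single (f : En n → ℝ) (y : En n) (i : Fin n) :
    gradient f y i = fderiv ℝ f y (EuclideanSpace.single i (1 : ℝ)) := by
  have h : inner ℝ (gradient f y) (EuclideanSpace.single i (1 : ℝ))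
      = fderiv ℝ f y (EuclideanSpace.single i (1 : ℝ)) := by
    unfold gradient
    exact InnerProductSpace.toDual_symm_apply
  rw [← h, EuclideanSpace.inner_single_right]
  simp

theorem sgrad_exp_add_const {ψ : En n → ℝ → ℝ} (hψ : IsTestFn ψ) (c : ℝ) (y : En n) (t : ℝ) :
    sgrad (fun x s => Real.exp (ψ x s + c)) y t = Real.exp (ψ y t + c) • sgrad ψ y t :=
  gradient_exp_add_const ((hψ.1 t).differentiable (by norm_num) y) c

theorem shess_exp_add_const {ψ : En n → ℝ → ℝ} (hψ : IsTestFn ψ) (c : ℝ) (y : En n) (t : ℝ) :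
    shess (fun x s => Real.exp (ψ x s + c)) y t
      = Real.exp (ψ y t + c) • (shess ψ y t + vouter (sgrad ψ y t) (sgrad ψ y t)) := by
  have hd : Differentiable ℝ fun x => ψ x t := (hψ.1 t).differentiable (by norm_num)
  have hd2 : Differentiable ℝ (fderiv ℝ fun x => ψ x t) :=
    ((hψ.1 t).fderiv_right (m := 1) (by norm_num)).differentiable (by norm_num)
  have hexp : ∀ x, HasFDerivAt (fun x => Real.exp (ψ x t + c))
      (Real.exp (ψ x t + c) • fderiv ℝ (fun x => ψ x t) x) x :=
    fun x => ((hd x).hasFDerivAt.add_const c).exp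
  ext i j
  have hfun : (fun x => fderiv ℝ (fun x' => Real.exp (ψ x' t + c)) x
        (EuclideanSpace.single j (1 : ℝ)))
      = fun x => Real.exp (ψ x t + c) *
        fderiv ℝ (fun x' => ψ x' t) x (EuclideanSpace.single j (1 : ℝ)) := by
    funext x
    rw [(hexp x).fderiv]
    rfl
  have hj : DifferentiableAt ℝ
      (fun x => fderiv ℝ (fun x' => ψ x' t) x (EuclideanSpace.single j (1 : ℝ))) y :=
    (hd2 y).clm_apply (differentiableAt_const _)
  simp only [shess, vouter, sgrad, Matrix.of_apply, Matrix.smul_apply, Matrix.add_apply,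
    gradient_apply_eq_fderiv_single, hfun]
  rw [((hexp y).fun_mul hj.hasFDerivAt).fderiv]
  simp only [add_apply, smul_apply, smul_eq_mul]
  ring

theorem tpartial_exp_add_const {ψ : En n → ℝ → ℝ} (hψ : IsTestFn ψ) (c : ℝ) (y : En n) (t : ℝ) :
    tpartial (fun x s => Real.exp (ψ x s + c)) y t = Real.exp (ψ y t + c) * tpartial ψ y t := by
  have hd : DifferentiableAt ℝ (fun s => ψ y s) t := (hψ.2 y).differentiable (by norm_num) t
  exact ((hd.hasDerivAt.add_const c).exp).deriv

theorem IsTestFn.exp_add_const {ψ : En n → ℝ → ℝ} (hψ : IsTestFn ψ) (c : ℝ) :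
    IsTestFn fun x s => Real.exp (ψ x s + c) :=
  ⟨fun t => ((hψ.1 t).add contDiff_const).exp, fun x => ((hψ.2 x).add contDiff_const).exp⟩

/-- The operator `H(Du, D²u) - u^{k-1} u_t` at the test function `exp (ψ + c)` is a positive
multiple of the logarithmic operator at `ψ`. -/
theorem operator_exp_add_const {H : En n → Sym n → ℝ} {k₁ : ℝ} (hB : CondB H k₁)
    {ψ : En n → ℝ → ℝ} (hψ : IsTestFn ψ) (c : ℝ) (y : En n) (t : ℝ) :
    H (sgrad (fun x s => Real.exp (ψ x s + c)) y t) (shess (fun x s => Real.exp (ψ x s + c)) y t)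
        - Real.exp (ψ y t + c) ^ (k₁ + 1 - 1)
          * tpartial (fun x s => Real.exp (ψ x s + c)) y t
      = Real.exp (ψ y t + c) ^ k₁ * Real.exp (ψ y t + c)
        * (H (sgrad ψ y t) (shess ψ y t + vouter (sgrad ψ y t) (sgrad ψ y t))
          - 1 * tpartial ψ y t) := by
  rw [sgrad_exp_add_const hψ, shess_exp_add_const hψ, tpartial_exp_add_const hψ, hB.2.1,
    hB.2.2 _ (Real.exp_pos _), abs_of_pos (Real.exp_pos _), add_sub_cancel_right]
  ring

theorem upperSemicontinuousOn_log {α : Type*} [TopologicalSpace α] {f : α → ℝ} {s : Set α}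
    (hf : UpperSemicontinuousOn f s) (hpos : ∀ x ∈ s, 0 < f x) :
    UpperSemicontinuousOn (fun x => Real.log (f x)) s := by
  intro x hx a ha
  filter_upwards [hf x hx (Real.exp a) ((Real.log_lt_iff_lt_exp (hpos x hx)).1 ha),
    self_mem_nhdsWithin] with z hz hzs
  exact (Real.log_lt_iff_lt_exp (hpos z hzs)).2 hz

theorem lowerSemicontinuousOn_log {α : Type*} [TopologicalSpace α] {f : α → ℝ} {s : Set α}
    (hf : LowerSemicontinuousOn f s) (hpos : ∀ x ∈ s, 0 < f x) :
    LowerSemicontinuousOn (fun x => Real.log (f x)) s := by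
  intro x hx a ha
  filter_upwards [hf x hx (Real.exp a) ((Real.lt_log_iff_exp_lt (hpos x hx)).1 ha),
    self_mem_nhdsWithin] with z hz hzs
  exact (Real.lt_log_iff_exp_lt (hpos z hzs)).2 hz

theorem ParSub.log {H : En n → Sym n → ℝ} {k₁ : ℝ} (hB : CondB H k₁) {Q : Set (En n × ℝ)}
    {u : En n → ℝ → ℝ} (hpos : ∀ q ∈ Q, 0 < u q.1 q.2) (hu : ParSub H (k₁ + 1) Q u) :
    ParSubLog H Q fun x t => Real.log (u x t) := by
  intro ψ hψ y t hyt hmax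
  set c := Real.log (u y t) - ψ y t with hc
  have hval : Real.exp (ψ y t + c) = u y t := by
    rw [hc, add_sub_cancel, Real.exp_log (hpos _ hyt)]
  have key := hu _ (hψ.exp_add_const c) y t hyt <| by
    filter_upwards [hmax, self_mem_nhdsWithin] with z hz hzQ
    have hle : u z.1 z.2 ≤ Real.exp (ψ z.1 z.2 + c) :=
      (Real.log_le_iff_le_exp (hpos z hzQ)).1 (by linarith)
    linarith
  rw [← hval, operator_exp_add_const hB hψ] at key
  exact nonneg_of_mul_nonneg_right key (by positivity)

theorem ParSuper.log {H : En n → Sym n → ℝ} {k₁ : ℝ} (hB : CondB H k₁) {Q : Set (En n × ℝ)}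
    {u : En n → ℝ → ℝ} (hpos : ∀ q ∈ Q, 0 < u q.1 q.2) (hu : ParSuper H (k₁ + 1) Q u) :
    ParSuperLog H Q fun x t => Real.log (u x t) := by
  intro ψ hψ y t hyt hmin
  set c := Real.log (u y t) - ψ y t with hc
  have hval : Real.exp (ψ y t + c) = u y t := by
    rw [hc, add_sub_cancel, Real.exp_log (hpos _ hyt)]
  have key := hu _ (hψ.exp_add_const c) y t hyt <| by
    filter_upwards [hmin, self_mem_nhdsWithin] with z hz hzQ
    have hle : Real.exp (ψ z.1 z.2 + c) ≤ u z.1 z.2 :=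
      (Real.le_log_iff_exp_le (hpos z hzQ)).1 (by linarith)
    linarith
  rw [← hval, operator_exp_add_const hB hψ] at key
  exact nonpos_of_mul_nonpos_right key (by positivity)

/-- change of variable w = log u turns sub/supersolutions of
H(Du,D²u) − u^{k−1}u_t = 0 into sub/supersolutions of H(Dw,D²w + Dw⊗Dw) − w_t = 0.
The time T is allowed to be infinite (T : ℝ≥0∞). -/
theorem log_change_of_variable
    {n : ℕ} (hn : 2 ≤ n)
    (H : En n → Sym n → ℝ) (k₁ k : ℝ) (hk : k = k₁ + 1)
    (hA : CondA H) (hB : CondB H k₁)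
    (Ω : Set (En n)) (hΩo : IsOpen Ω) (hΩc : IsConnected Ω)
    (hΩb : Bornology.IsBounded Ω)
    (T : ENNReal) (hT : 0 < T)
    (Q : Set (En n × ℝ))
    (hQ : Q = Ω ×ˢ {t : ℝ | 0 < t ∧ ENNReal.ofReal t < T}) :
    (∀ u : En n → ℝ → ℝ,
      UpperSemicontinuousOn (fun q : En n × ℝ => u q.1 q.2) Q →
      (∀ q ∈ Q, 0 < u q.1 q.2) →
      ParSub H k Q u →
      UpperSemicontinuousOn (fun q : En n × ℝ => Real.log (u q.1 q.2)) Q ∧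
      ParSubLog H Q (fun x t => Real.log (u x t))) ∧
    (∀ u : En n → ℝ → ℝ,
      LowerSemicontinuousOn (fun q : En n × ℝ => u q.1 q.2) Q →
      (∀ q ∈ Q, 0 < u q.1 q.2) →
      ParSuper H k Q u →
      LowerSemicontinuousOn (fun q : En n × ℝ => Real.log (u q.1 q.2)) Q ∧
      ParSuperLog H Q (fun x t => Real.log (u x t))) := by
  subst hk
  exact ⟨fun u husc hpos hu => ⟨upperSemicontinuousOn_log husc hpos, ParSub.log hB hpos hu⟩,
    fun u hlsc hpos hu => ⟨lowerSemicontinuousOn_log hlsc hpos, ParSuper.log hB hpos hu⟩⟩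

end DNLP
end
end

section
/- Let n ≥ 2, let Ω ⊂ ℝ^n be a bounded domain satisfying an outer ball condition, and let H satisfy Conditions A, B, C with k = k₁ + 1 ≥ 1. Let δ ≠ 0 and θ ∈ ℝ. Then there exists ψ ∈ C(cl(Ω)) which is a viscosity solution of H(Dψ, D²ψ) = δ in Ω with ψ = θ on ∂Ω. If δ > 0 then ψ ≤ θ in Ω, and if δ < 0 then ψ ≥ θ in Ω. Moreover ψ = θ + |δ|^{1/k} η, where η ∈ C(cl(Ω)) is a viscosity solution of H(Dη, D²η) = δ/|δ| in Ω with η = 0 on ∂Ω. -/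
open Set Filter Metric

noncomputable section

namespace DNLP

variable {n : ℕ}

/-! ### Second-order expansions and the maximum principle for test functions -/

/-- The matrix of the bilinear form `(v, w) ↦ ⟪A v, w⟫` in the standard basis. -/
def hessMat (A : En n →L[ℝ] En n) : Sym n :=
  Matrix.of fun i j => A (EuclideanSpace.single i (1:ℝ)) j

/-- `g` has gradient field `p` near `y`, and `p` is differentiable at `y` with derivative `A`. -/
structure HasHessAt (g : En n → ℝ) (p : En n → En n) (A : En n →L[ℝ] En n) (y : En n) :
    Prop where
  grad : ∀ᶠ x in nhds y, HasGradientAt g (p x) x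
  hasFDerivAt : HasFDerivAt p A y

namespace HasHessAt

variable {g g' : En n → ℝ} {p p' : En n → En n} {A A' : En n →L[ℝ] En n} {y : En n}

lemma gradient_eq (h : HasHessAt g p A y) : gradient g y = p y :=
  h.grad.self_of_nhds.gradient

lemma ehess_eq (h : HasHessAt g p A y) : ehess g y = hessMat A := by
  ext i j
  simp only [ehess, hessMat, Matrix.of_apply]
  have h1 : (fun x => fderiv ℝ g x (EuclideanSpace.single j (1:ℝ))) =ᶠ[nhds y]
      fun x => EuclideanSpace.proj (𝕜 := ℝ) j (p x) := by
    filter_upwards [h.grad] with x hx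
    rw [(hasGradientAt_iff_hasFDerivAt.1 hx).fderiv]
    simp [EuclideanSpace.inner_single_right]
  have h2 : HasFDerivAt (fun x => EuclideanSpace.proj (𝕜 := ℝ) j (p x))
      ((EuclideanSpace.proj (𝕜 := ℝ) j).comp A) y :=
    (EuclideanSpace.proj (𝕜 := ℝ) j).hasFDerivAt.comp y h.hasFDerivAt
  rw [h1.fderiv_eq, h2.fderiv]
  simp

lemma symm (h : HasHessAt g p A y) (v w : En n) : inner ℝ (A v) w = inner ℝ (A w) v := by
  have h1 : ∀ᶠ x in nhds y, HasFDerivAt g (innerSL ℝ (p x)) x := by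
    filter_upwards [h.grad] with x hx
    exact hasGradientAt_iff_hasFDerivAt.1 hx
  have h2 : HasFDerivAt (fun x => innerSL ℝ (p x)) ((innerSL ℝ).comp A) y :=
    ((innerSL ℝ : En n →L[ℝ] En n →L[ℝ] ℝ).hasFDerivAt (x := p y)).comp y h.hasFDerivAt
  simpa using second_derivative_symmetric_of_eventually h1 h2 v w

lemma isHermitian (h : HasHessAt g p A y) : (hessMat A).IsHermitian := by
  ext i j
  have := h.symm (EuclideanSpace.single i (1:ℝ)) (EuclideanSpace.single j (1:ℝ))
  simp only [EuclideanSpace.inner_single_right] at this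
  simpa [hessMat] using this.symm

lemma sub (h : HasHessAt g p A y) (h' : HasHessAt g' p' A' y) :
    HasHessAt (fun x => g x - g' x) (fun x => p x - p' x) (A - A') y where
  grad := by
    filter_upwards [h.grad, h'.grad] with x hx hx'
    rw [hasGradientAt_iff_hasFDerivAt] at *
    rw [map_sub]
    exact hx.sub hx'
  hasFDerivAt := h.hasFDerivAt.sub h'.hasFDerivAt

lemma add (h : HasHessAt g p A y) (h' : HasHessAt g' p' A' y) :
    HasHessAt (fun x => g x + g' x) (fun x => p x + p' x) (A + A') y where
  grad := by
    filter_upwards [h.grad, h'.grad] with x hx hx'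
    rw [hasGradientAt_iff_hasFDerivAt] at *
    rw [map_add]
    exact hx.add hx'
  hasFDerivAt := h.hasFDerivAt.add h'.hasFDerivAt

lemma const_add (h : HasHessAt g p A y) (b : ℝ) : HasHessAt (fun x => b + g x) p A y where
  grad := by
    filter_upwards [h.grad] with x hx
    rw [hasGradientAt_iff_hasFDerivAt] at *
    exact hx.const_add b
  hasFDerivAt := h.hasFDerivAt

lemma const_mul (h : HasHessAt g p A y) (a : ℝ) :
    HasHessAt (fun x => a * g x) (fun x => a • p x) (a • A) y where
  grad := by
    filter_upwards [h.grad] with x hx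
    rw [hasGradientAt_iff_hasFDerivAt] at *
    rw [map_smulₛₗ]
    exact hx.const_mul a
  hasFDerivAt := h.hasFDerivAt.const_smul a

lemma comp_add_const (a : En n) (h : HasHessAt g p A (y + a)) :
    HasHessAt (fun x => g (x + a)) (fun x => p (x + a)) A y where
  grad := by
    have hc : Tendsto (fun x => x + a) (nhds y) (nhds (y + a)) :=
      (continuous_id.add continuous_const).tendsto y
    filter_upwards [hc.eventually h.grad] with x hx
    rw [hasGradientAt_iff_hasFDerivAt] at *
    exact (hasFDerivAt_comp_add_right a).2 hx
  hasFDerivAt := (hasFDerivAt_comp_add_right a).2 h.hasFDerivAt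

lemma eq_zero_of_isLocalMax (h : HasHessAt g p A y) (hm : IsLocalMax g y) : p y = 0 := by
  have := hm.hasFDerivAt_eq_zero (hasGradientAt_iff_hasFDerivAt.1 h.grad.self_of_nhds)
  simpa using this

lemma inner_nonpos_of_isLocalMax (h : HasHessAt g p A y) (hm : IsLocalMax g y) (v : En n) :
    inner ℝ (A v) v ≤ 0 := by
  by_contra! hpos
  have hline : ∀ t : ℝ, HasDerivAt (fun t : ℝ => y + t • v) v t := fun t => by
    simpa using ((hasDerivAt_id t).smul_const v).const_add y
  have hc : Tendsto (fun t : ℝ => y + t • v) (nhds 0) (nhds y) := by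
    simpa using (hline 0).continuousAt.tendsto
  have h1 : ∀ᶠ t in nhds (0:ℝ),
      HasDerivAt (fun t : ℝ => g (y + t • v)) (inner ℝ (p (y + t • v)) v) t := by
    filter_upwards [hc.eventually h.grad] with t ht
    rw [hasGradientAt_iff_hasFDerivAt] at ht
    simpa [Function.comp_def] using ht.comp_hasDerivAt t (hline t)
  have h2 : HasDerivAt (fun t : ℝ => inner ℝ (p (y + t • v)) v) (inner ℝ (A v) v) 0 := by
    have hp : HasFDerivAt p A (y + (0:ℝ) • v) := by simpa using h.hasFDerivAt
    have := (hp.comp_hasDerivAt (0:ℝ) (hline 0)).inner ℝ (hasDerivAt_const (0:ℝ) v)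
    simpa using this
  have h3 : deriv (fun t : ℝ => g (y + t • v)) =ᶠ[nhds 0]
      fun t => inner ℝ (p (y + t • v)) v := by
    filter_upwards [h1] with t ht using ht.deriv
  have h4 : deriv (deriv fun t : ℝ => g (y + t • v)) 0 = inner ℝ (A v) v := by
    rw [h3.deriv_eq, h2.deriv]
  have hmax : IsLocalMax (fun t : ℝ => g (y + t • v)) 0 := by
    have := hc.eventually hm
    simpa [IsLocalMax, IsMaxFilter] using this
  have hmin : IsLocalMin (fun t : ℝ => g (y + t • v)) 0 := by
    refine isLocalMin_of_deriv_deriv_pos (h4 ▸ hpos) hmax.deriv_eq_zero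
      h1.self_of_nhds.continuousAt
  have hconst : (fun t : ℝ => g (y + t • v)) =ᶠ[nhds 0] fun _ => g (y + (0:ℝ) • v) := by
    filter_upwards [hmax, hmin] with t h1 h2 using le_antisymm h1 h2
  have h5 : deriv (fun t : ℝ => g (y + t • v)) =ᶠ[nhds 0] fun _ => (0:ℝ) := by
    simpa using hconst.deriv
  rw [h5.deriv_eq] at h4
  simp at h4
  linarith

end HasHessAt

lemma inner_eq_hessMat (A : En n →L[ℝ] En n) (v : Fin n → ℝ) :
    star v ⬝ᵥ (hessMat A).mulVec v = inner ℝ (A (WithLp.toLp 2 v)) (WithLp.toLp 2 v) := by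
  have hv : (WithLp.toLp 2 v : En n) = ∑ i, v i • EuclideanSpace.single i (1:ℝ) := by
    ext j
    simp [Pi.single_apply]
  have hA : ∀ j, A (WithLp.toLp 2 v) j
      = ∑ i, v i * A (EuclideanSpace.single i (1:ℝ)) j := by
    intro j
    rw [hv, map_sum]
    simp
  simp only [PiLp.inner_apply, hA]
  simp only [dotProduct, Matrix.mulVec, hessMat, Matrix.of_apply, Finset.mul_sum,
    RCLike.inner_apply, conj_trivial, star_trivial]
  rw [Finset.sum_comm]
  refine Finset.sum_congr rfl fun i _ => Finset.sum_congr rfl fun j _ => ?_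
  ring

lemma hessMat_sub (A B : En n →L[ℝ] En n) : hessMat (A - B) = hessMat A - hessMat B := by
  ext i j; simp [hessMat]

lemma hessMat_add (A B : En n →L[ℝ] En n) : hessMat (A + B) = hessMat A + hessMat B := by
  ext i j; simp [hessMat]

lemma hessMat_smul (a : ℝ) (A : En n →L[ℝ] En n) : hessMat (a • A) = a • hessMat A := by
  ext i j; simp [hessMat]

lemma continuous_hessMat : Continuous (hessMat : (En n →L[ℝ] En n) → Sym n) := by
  refine continuous_matrix fun i j => ?_
  simp only [hessMat, Matrix.of_apply]
  fun_prop

lemma _root_.ContDiff.contDiff_gradient {φ : En n → ℝ} (h : ContDiff ℝ 2 φ) :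
    ContDiff ℝ 1 (gradient φ) := by
  have h1 : ContDiff ℝ 1 (fderiv ℝ φ) := h.fderiv_right (by norm_num)
  exact (InnerProductSpace.toDual ℝ (En n)).symm.contDiff.comp h1

lemma _root_.ContDiff.hasHessAt {φ : En n → ℝ} (h : ContDiff ℝ 2 φ) (y : En n) :
    HasHessAt φ (gradient φ) (fderiv ℝ (gradient φ) y) y where
  grad := Eventually.of_forall fun x =>
    ((h.differentiable (by norm_num)) x).hasGradientAt
  hasFDerivAt := ((h.contDiff_gradient.differentiable (by norm_num)) y).hasFDerivAt

lemma _root_.ContDiff.continuous_ehess {φ : En n → ℝ} (h : ContDiff ℝ 2 φ) :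
    Continuous (ehess φ) := by
  have : ehess φ = fun y => hessMat (fderiv ℝ (gradient φ) y) :=
    funext fun y => (h.hasHessAt y).ehess_eq
  rw [this]
  exact continuous_hessMat.comp (h.contDiff_gradient.continuous_fderiv (by norm_num))

lemma HasHessAt.le_of_isLocalMax {H : En n → Sym n → ℝ} (hA : CondA H) {g g' : En n → ℝ}
    {p p' : En n → En n} {A A' : En n →L[ℝ] En n} {y : En n}
    (h : HasHessAt g p A y) (h' : HasHessAt g' p' A' y)
    (hm : IsLocalMax (fun x => g x - g' x) y) :
    H (p y) (hessMat A) ≤ H (p' y) (hessMat A') := by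
  have hs := h.sub h'
  have hp : p y = p' y := sub_eq_zero.1 (hs.eq_zero_of_isLocalMax hm)
  rw [hp]
  refine hA.2.2 _ _ _ ?_
  refine Matrix.PosSemidef.of_dotProduct_mulVec_nonneg
    (h'.isHermitian.sub h.isHermitian) fun v => ?_
  rw [← hessMat_sub, inner_eq_hessMat]
  have := hs.inner_nonpos_of_isLocalMax hm (WithLp.toLp 2 v)
  simp only [sub_apply, inner_sub_left] at this ⊢
  linarith

/-- The derivative at `x` of the gradient field of `x ↦ f (‖x - q‖²)`, where `f` has first and
second derivatives `a` and `b`, and `z = x - q`. -/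
def radialHess (a b : ℝ) (z : En n) : En n →L[ℝ] En n :=
  (2 * a) • ContinuousLinearMap.id ℝ (En n) + (4 * b) • (innerSL ℝ z).smulRight z

lemma hessMat_radialHess (a b : ℝ) (z : En n) :
    hessMat (radialHess a b z) = (2 * a) • (1 : Sym n) + (4 * b) • vouter z z := by
  ext i j
  simp [hessMat, radialHess, vouter, EuclideanSpace.inner_single_right, Matrix.one_apply,
    eq_comm]

lemma hasHessAt_radial {f f₁ : ℝ → ℝ} {f₂ : ℝ} (q y : En n)
    (h1 : ∀ᶠ s in nhds (‖y - q‖ ^ 2), HasDerivAt f (f₁ s) s)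
    (h2 : HasDerivAt f₁ f₂ (‖y - q‖ ^ 2)) :
    HasHessAt (fun x => f (‖x - q‖ ^ 2)) (fun x => (2 * f₁ (‖x - q‖ ^ 2)) • (x - q))
      (radialHess (f₁ (‖y - q‖ ^ 2)) f₂ (y - q)) y where
  grad := by
    have hc : Tendsto (fun x : En n => ‖x - q‖ ^ 2) (nhds y) (nhds (‖y - q‖ ^ 2)) :=
      (by fun_prop : Continuous fun x : En n => ‖x - q‖ ^ 2).tendsto y
    filter_upwards [hc.eventually h1] with x hx
    rw [hasGradientAt_iff_hasFDerivAt]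
    have hs := ((hasFDerivAt_id (𝕜 := ℝ) x).sub_const q).norm_sq
    refine (hx.comp_hasFDerivAt x hs).congr_fderiv ?_
    ext v
    simp
    ring
  hasFDerivAt := by
    have hs := ((hasFDerivAt_id (𝕜 := ℝ) y).sub_const q).norm_sq
    refine (((h2.comp_hasFDerivAt y hs).const_mul 2).smul
      ((hasFDerivAt_id (𝕜 := ℝ) y).sub_const q)).congr_fderiv ?_
    ext v i
    simp [radialHess]
    ring

lemma hasHessAt_mul_norm_sq (κ : ℝ) (q y : En n) :
    HasHessAt (fun x => κ * ‖x - q‖ ^ 2) (fun x => (2 * κ) • (x - q))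
      (radialHess κ 0 (y - q)) y :=
  hasHessAt_radial (f := fun s => κ * s) (f₁ := fun _ => κ) q y
    (Eventually.of_forall fun s => by simpa using (hasDerivAt_id s).const_mul κ)
    (hasDerivAt_const _ _)

/-! ### Local properties of viscosity sub- and supersolutions -/

section Viscosity

variable {H : En n → Sym n → ℝ} {Ω : Set (En n)} {δ : ℝ}

/-- If `w` touches `v` from below at `y`, then maxima of `v - φ` at `y` are maxima of `w - φ`. -/
lemma isLocalMax_of_touching {v w φ : En n → ℝ} {y : En n} (hle : ∀ᶠ x in nhds y, w x ≤ v x)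
    (heq : w y = v y) (hm : IsLocalMax (fun x => v x - φ x) y) :
    IsLocalMax (fun x => w x - φ x) y := by
  filter_upwards [hle, hm] with x h1 h2
  linarith

lemma EllSub.max {v w f : En n → ℝ} (hv : EllSub H Ω v f) (hw : EllSub H Ω w f) :
    EllSub H Ω (fun x => max (v x) (w x)) f := by
  intro φ hφ y hy hm
  rcases le_total (v y) (w y) with h | h
  · refine hw φ hφ y hy ?_
    filter_upwards [hm] with x hx
    have := le_max_right (v x) (w x)
    simp only [max_eq_right h] at hx ⊢
    linarith
  · refine hv φ hφ y hy ?_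
    filter_upwards [hm] with x hx
    have := le_max_left (v x) (w x)
    simp only [max_eq_left h] at hx ⊢
    linarith

/-- A function which is locally twice differentiable and a classical subsolution is a viscosity
subsolution. -/
lemma ellSub_of_hasHessAt (hA : CondA H) (hΩo : IsOpen Ω) {w g : En n → ℝ} {p : En n → En n}
    {A : En n → En n →L[ℝ] En n} (hwg : ∀ x ∈ Ω, w x = g x)
    (hg : ∀ x ∈ Ω, HasHessAt g p (A x) x) (hH : ∀ x ∈ Ω, δ ≤ H (p x) (hessMat (A x))) :
    EllSub H Ω w (fun _ => δ) := by
  intro φ hφ y hy hm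
  rw [(hφ.hasHessAt y).ehess_eq]
  refine (hH y hy).trans ((hg y hy).le_of_isLocalMax hA (hφ.hasHessAt y) ?_)
  have hm' := hm.isLocalMax (hΩo.mem_nhds hy)
  refine isLocalMax_of_touching ?_ (hwg y hy).symm hm'
  filter_upwards [hΩo.mem_nhds hy] with x hx using (hwg x hx).ge

/-- For a `C²` function `φ`, the operator applied to `φ + κ ‖· - y‖²` is continuous in `(κ, x)`,
so a strict inequality at `y` persists. -/
lemma continuous_quadratic_perturbation (hA : CondA H) {φ : En n → ℝ} (hφ : ContDiff ℝ 2 φ)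
    (y : En n) :
    Continuous fun z : ℝ × En n => H (gradient φ z.2 + (2 * z.1) • (z.2 - y))
      (ehess φ z.2 + (2 * z.1) • (1 : Sym n)) := by
  have h1 : Continuous (gradient φ) := hφ.contDiff_gradient.continuous
  have h2 := hφ.continuous_ehess
  exact hA.1.comp (f := fun z : ℝ × En n => (gradient φ z.2 + (2 * z.1) • (z.2 - y),
    ehess φ z.2 + (2 * z.1) • (1 : Sym n))) (by fun_prop)

lemma hasHessAt_quadratic_perturbation {φ : En n → ℝ} (hφ : ContDiff ℝ 2 φ) (κ : ℝ)
    (y x : En n) :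
    HasHessAt (fun x => φ x + κ * ‖x - y‖ ^ 2) (fun x => gradient φ x + (2 * κ) • (x - y))
      (fderiv ℝ (gradient φ) x + radialHess κ 0 (x - y)) x ∧
    hessMat (fderiv ℝ (gradient φ) x + radialHess κ 0 (x - y))
      = ehess φ x + (2 * κ) • (1 : Sym n) := by
  refine ⟨(hφ.hasHessAt x).add (hasHessAt_mul_norm_sq κ y x), ?_⟩
  rw [hessMat_add, hessMat_radialHess, (hφ.hasHessAt x).ehess_eq]
  simp

/-- The supremum of a family of continuous subsolutions is a subsolution. -/
lemma ellSub_of_isLUB (hA : CondA H) (hΩo : IsOpen Ω) {S : Set (En n → ℝ)} {u : En n → ℝ}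
    (hSc : ∀ v ∈ S, Continuous v) (hS : ∀ v ∈ S, EllSub H Ω v (fun _ => δ))
    (hu : ∀ x ∈ Ω, IsLUB ((fun v : En n → ℝ => v x) '' S) (u x)) :
    EllSub H Ω u (fun _ => δ) := by
  intro φ hφ y hy hm
  by_contra! hlt
  have hcont := continuous_quadratic_perturbation hA hφ y
  have hnear : ∀ᶠ z in nhds ((0:ℝ), y), H (gradient φ z.2 + (2 * z.1) • (z.2 - y))
      (ehess φ z.2 + (2 * z.1) • (1 : Sym n)) < δ :=
    hcont.continuousAt.eventually (gt_mem_nhds (by simpa using hlt))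
  obtain ⟨r₁, hr₁, hball⟩ := Metric.eventually_nhds_iff.1 hnear
  have hm' := hm.isLocalMax (hΩo.mem_nhds hy)
  obtain ⟨r₂, hr₂, hball₂⟩ := Metric.eventually_nhds_iff.1 (hm'.and (hΩo.mem_nhds hy))
  set κ : ℝ := r₁ / 2 with hκ
  set r : ℝ := min r₁ r₂ / 2 with hr
  have hκ0 : 0 < κ := by positivity
  have hr0 : 0 < r := by positivity
  have hrr₁ : r < r₁ := by have := min_le_left r₁ r₂; have := lt_min hr₁ hr₂; linarith
  have hrr₂ : r < r₂ := by have := min_le_right r₁ r₂; have := lt_min hr₁ hr₂; linarith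
  obtain ⟨_, ⟨v, hvS, rfl⟩, hv⟩ := (lt_isLUB_iff (hu y hy)).1
    (show u y - κ * r ^ 2 < u y by have : 0 < κ * r ^ 2 := by positivity
                                   linarith)
  have hvc := hSc v hvS
  have hφc : Continuous φ := hφ.continuous
  obtain ⟨x, hxB, hxmax⟩ := (isCompact_closedBall y r).exists_isMaxOn
    ⟨y, mem_closedBall_self hr0.le⟩
    (f := fun x => v x - (φ x + κ * ‖x - y‖ ^ 2)) (by fun_prop)
  have hxd : dist x y ≤ r := hxB
  have hxu := (hball₂ (hxd.trans_lt hrr₂)).1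
  have hxΩ : x ∈ Ω := (hball₂ (hxd.trans_lt hrr₂)).2
  have h1 := hxmax (mem_closedBall_self hr0.le)
  have h2 : v x ≤ u x := (hu x hxΩ).1 ⟨v, hvS, rfl⟩
  simp only [sub_self, norm_zero, mem_ofPred_eq] at h1 hv hxu
  have hlt' : ‖x - y‖ < r := by
    have : κ * ‖x - y‖ ^ 2 < κ * r ^ 2 := by nlinarith
    have := lt_of_mul_lt_mul_left this hκ0.le
    exact lt_of_pow_lt_pow_left₀ 2 hr0.le this
  have hxint : closedBall y r ∈ nhds x :=
    Filter.mem_of_superset (isOpen_ball.mem_nhds (by rwa [mem_ball, dist_eq_norm]))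
      ball_subset_closedBall
  have hper := hasHessAt_quadratic_perturbation hφ κ y x
  have hcd : ContDiff ℝ 2 fun x => φ x + κ * ‖x - y‖ ^ 2 :=
    hφ.add (contDiff_const.mul ((contDiff_id.sub contDiff_const).norm_sq ℝ))
  have hsub := hS v hvS _ hcd x hxΩ ((hxmax.isLocalMax hxint).on _)
  rw [hper.1.gradient_eq, hper.1.ehess_eq, hper.2] at hsub
  refine absurd (hball (y := (κ, x)) ?_) (not_lt.2 hsub)
  rw [Prod.dist_eq, max_lt_iff]
  refine ⟨?_, hxd.trans_lt hrr₁⟩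
  rw [Real.dist_eq, sub_zero, abs_of_pos hκ0]
  linarith

end Viscosity

/-! ### Barriers -/

/-- The half of Condition C used for the equation with positive right-hand side. -/
def OuterCoercive (H : En n → Sym n → ℝ) : Prop :=
  ∃ Λ₁ : ℝ, ∀ Λ : ℝ, Λ₁ ≤ Λ → ∀ e : En n, ‖e‖ = 1 → 0 < H e (Λ • vouter e e - 1)

/-- The admissible class for Perron's method: continuous nonpositive subsolutions. -/
def perronClass (H : En n → Sym n → ℝ) (Ω : Set (En n)) (δ : ℝ) : Set (En n → ℝ) :=
  {v | Continuous v ∧ (∀ x, v x ≤ 0) ∧ EllSub H Ω v (fun _ => δ)}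

section Perron

variable {H : En n → Sym n → ℝ} {k₁ δ : ℝ} {Ω : Set (En n)}

lemma vouter_smul (a : ℝ) (z : En n) : vouter (a • z) (a • z) = a ^ 2 • vouter z z := by
  ext i j
  simp [vouter]
  ring

lemma continuous_vouter_self : Continuous fun z : En n => vouter z z := by
  refine continuous_matrix fun i j => ?_
  simp only [vouter, Matrix.of_apply]
  fun_prop

lemma pos_radial (hB : CondB H k₁) {Λ : ℝ}
    (hΛ : ∀ e : En n, ‖e‖ = 1 → 0 < H e (Λ • vouter e e - 1)) {a : ℝ} (ha : 0 < a) {z : En n}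
    (hz : z ≠ 0) :
    0 < H ((-a) • z) ((-a) • (1 : Sym n) + (a * Λ / ‖z‖ ^ 2) • vouter z z) := by
  have hz' : 0 < ‖z‖ := norm_pos_iff.2 hz
  have he : ‖(‖z‖⁻¹ • z : En n)‖ = 1 := by
    rw [norm_smul, norm_inv, norm_norm, inv_mul_cancel₀ hz'.ne']
  have hpos := hΛ _ he
  have hp : (-a) • z = (-(a * ‖z‖)) • (‖z‖⁻¹ • z) := by
    rw [smul_smul]; congr 1; field_simp
  have hX : (-a) • (1 : Sym n) + (a * Λ / ‖z‖ ^ 2) • vouter z z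
      = a • (Λ • vouter (‖z‖⁻¹ • z) (‖z‖⁻¹ • z) - 1) := by
    rw [vouter_smul, smul_sub, smul_smul, smul_smul, neg_smul, neg_add_eq_sub]
    congr 2; field_simp
  rw [hp, hX, hB.2.1, hB.2.2 a ha]
  have : 0 < |(-(a * ‖z‖))| := abs_pos.2 (neg_ne_zero.2 (by positivity))
  positivity

lemma exists_barrier (hA : CondA H) (hB : CondB H k₁) (hC : OuterCoercive H)
    (hΩo : IsOpen Ω) (hΩn : Ω.Nonempty) (hΩb : Bornology.IsBounded Ω)
    {q : En n} {ρ : ℝ} (hρ : 0 < ρ) (hball : ball q ρ ⊆ Ωᶜ) :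
    ∃ w ∈ perronClass H Ω δ, ∀ x ∈ closedBall q ρ, w x = 0 := by
  obtain ⟨Λ₁, hΛ₁⟩ := hC
  set β : ℝ := max 1 Λ₁ with hβ
  have hβ1 : 1 ≤ β := le_max_left _ _
  have hΛ := hΛ₁ (2 * (β + 1)) (by have : Λ₁ ≤ β := le_max_right _ _
                                   linarith)
  have hcl : ∀ x ∈ closure Ω, ρ ≤ ‖x - q‖ := by
    intro x hx
    have : closure Ω ⊆ (ball q ρ)ᶜ :=
      closure_minimal (subset_compl_comm.1 hball) isOpen_ball.isClosed_compl
    simpa [dist_eq_norm] using this hx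
  let f₁ : ℝ → ℝ := fun s => -β * s ^ (-β - 1)
  let f₂ : ℝ → ℝ := fun s => -β * ((-β - 1) * s ^ (-β - 1 - 1))
  let P : En n → ℝ := fun x => H ((2 * f₁ (‖x - q‖ ^ 2)) • (x - q))
    ((2 * f₁ (‖x - q‖ ^ 2)) • (1 : Sym n) + (4 * f₂ (‖x - q‖ ^ 2)) • vouter (x - q) (x - q))
  have hsq : ∀ x ∈ closure Ω, 0 < ‖x - q‖ ^ 2 := fun x hx => by
    have := hρ.trans_le (hcl x hx)
    positivity
  have hPc : ContinuousOn P (closure Ω) := by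
    have hs : ContinuousOn (fun x : En n => ‖x - q‖ ^ 2) (closure Ω) :=
      Continuous.continuousOn (by fun_prop)
    have hpow : ∀ e : ℝ, ContinuousOn (fun x : En n => (‖x - q‖ ^ 2) ^ e) (closure Ω) :=
      fun e => hs.rpow_const fun x hx => Or.inl (hsq x hx).ne'
    have hv : ContinuousOn (fun x : En n => vouter (x - q) (x - q)) (closure Ω) :=
      (continuous_vouter_self.comp (continuous_id.sub continuous_const)).continuousOn
    have h1 := hpow (-β - 1)
    have h2 := hpow (-β - 1 - 1)
    exact hA.1.comp_continuousOn (f := fun x : En n => ((2 * f₁ (‖x - q‖ ^ 2)) • (x - q),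
      (2 * f₁ (‖x - q‖ ^ 2)) • (1 : Sym n)
        + (4 * f₂ (‖x - q‖ ^ 2)) • vouter (x - q) (x - q))) (by simp only [f₁, f₂]; fun_prop)
  have hPpos : ∀ x ∈ closure Ω, 0 < P x := by
    intro x hx
    have hz : x - q ≠ 0 := norm_pos_iff.1 (hρ.trans_le (hcl x hx))
    have hs := hsq x hx
    have := pos_radial hB hΛ (a := 2 * β * (‖x - q‖ ^ 2) ^ (-β - 1)) (by positivity) hz
    convert this using 2
    · simp only [f₁]; congr 1; ring
    · simp only [f₁, f₂]
      congr 2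
      · ring
      · rw [Real.rpow_sub_one hs.ne' (-β - 1)]
        field_simp
        ring
  obtain ⟨x₀, hx₀, hmin⟩ := hΩb.isCompact_closure.exists_isMinOn hΩn.closure hPc
  have hP0 := hPpos x₀ hx₀
  set c : ℝ := max 1 (δ / P x₀) with hc
  have hc1 : 1 ≤ c := le_max_left _ _
  have hcδ : δ ≤ c * P x₀ := (div_le_iff₀ hP0).1 (le_max_right _ _)
  refine ⟨fun x => -c * (ρ ^ 2) ^ (-β) + c * (max (‖x - q‖) ρ ^ 2) ^ (-β), ⟨?_, ?_, ?_⟩, ?_⟩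
  · have hb : Continuous fun x : En n => max (‖x - q‖) ρ ^ 2 := by fun_prop
    exact continuous_const.add (continuous_const.mul (hb.rpow_const fun x => Or.inl
      (pow_pos (lt_max_of_lt_right hρ) 2).ne'))
  · intro x
    have : (max (‖x - q‖) ρ ^ 2) ^ (-β) ≤ (ρ ^ 2) ^ (-β) :=
      Real.rpow_le_rpow_of_nonpos (by positivity)
        (pow_le_pow_left₀ hρ.le (le_max_right _ _) 2) (by linarith)
    nlinarith
  · refine ellSub_of_hasHessAt hA hΩo
      (g := fun x => -c * (ρ ^ 2) ^ (-β) + c * (‖x - q‖ ^ 2) ^ (-β))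
      (p := fun x => c • ((2 * f₁ (‖x - q‖ ^ 2)) • (x - q)))
      (A := fun x => c • radialHess (f₁ (‖x - q‖ ^ 2)) (f₂ (‖x - q‖ ^ 2)) (x - q)) ?_ ?_ ?_
    · intro x hx
      simp only [max_eq_left (hcl x (subset_closure hx))]
    · intro x hx
      have hs := hsq x (subset_closure hx)
      refine ((hasHessAt_radial (f := fun s => s ^ (-β)) q x ?_ ?_).const_mul c).const_add _
      · filter_upwards [lt_mem_nhds hs] with s hs
        exact Real.hasDerivAt_rpow_const (Or.inl hs.ne')
      · exact (Real.hasDerivAt_rpow_const (Or.inl hs.ne')).const_mul _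
    · intro x hx
      rw [hessMat_smul, hessMat_radialHess, hB.2.1, hB.2.2 c (by linarith)]
      have h1 : P x₀ ≤ P x := hmin (subset_closure hx)
      have h2 : 1 ≤ |c| ^ k₁ :=
        Real.one_le_rpow (by rw [abs_of_nonneg (by linarith)]; exact hc1) hB.1
      have h3 : c * P x₀ ≤ c * P x := mul_le_mul_of_nonneg_left h1 (by linarith)
      have h4 : 0 ≤ c * P x := by nlinarith
      calc δ ≤ c * P x := hcδ.trans h3
        _ ≤ |c| ^ k₁ * (c * P x) := le_mul_of_one_le_left h4 h2
  · intro x hx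
    have : ‖x - q‖ ≤ ρ := by simpa [dist_eq_norm] using hx
    simp only [max_eq_right this]
    ring

lemma max_mem_perronClass {v w : En n → ℝ} (hv : v ∈ perronClass H Ω δ)
    (hw : w ∈ perronClass H Ω δ) : (fun x => max (v x) (w x)) ∈ perronClass H Ω δ :=
  ⟨hv.1.max hw.1, fun x => max_le (hv.2.1 x) (hw.2.1 x), hv.2.2.max hw.2.2⟩

/-- Near the complement of `Ω` some member of the admissible class is close to zero. -/
lemma exists_uniform_barrier (hA : CondA H) (hB : CondB H k₁) (hC : OuterCoercive H)
    (hΩo : IsOpen Ω) (hΩn : Ω.Nonempty) (hΩb : Bornology.IsBounded Ω) (hOB : OuterBallCond Ω)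
    (hne : (perronClass H Ω δ).Nonempty) {ε : ℝ} (hε : 0 < ε) :
    ∃ L ∈ perronClass H Ω δ, ∃ η > 0, ∀ x ∈ Ω, ∀ z ∉ Ω, dist z x < η → -ε ≤ L x := by
  have hcomp : IsCompact (frontier Ω) :=
    hΩb.isCompact_closure.of_isClosed_subset isClosed_frontier frontier_subset_closure
  have : Nonempty (perronClass H Ω δ) := hne.to_subtype
  obtain ⟨⟨L, hL⟩, hLf⟩ := hcomp.elim_directed_cover
    (fun v : perronClass H Ω δ => {x | -ε < v.1 x})
    (fun v => isOpen_lt continuous_const v.2.1)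
    (fun y hy => by
      obtain ⟨ρ, hρ, q, -, hball, hyq⟩ := hOB y hy
      obtain ⟨w, hw, hw0⟩ := exists_barrier (δ := δ) hA hB hC hΩo hΩn hΩb hρ hball
      refine mem_iUnion.2 ⟨⟨w, hw⟩, ?_⟩
      have := hw0 y (sphere_subset_closedBall hyq)
      simpa [this] using hε)
    (fun v w => ⟨⟨_, max_mem_perronClass v.2 w.2⟩,
      fun x (hx : -ε < v.1 x) => show -ε < max (v.1 x) (w.1 x) from lt_max_of_lt_left hx,
      fun x (hx : -ε < w.1 x) => show -ε < max (v.1 x) (w.1 x) from lt_max_of_lt_right hx⟩)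
  have hK : IsCompact (closure Ω \ {x | -ε < L x}) :=
    hΩb.isCompact_closure.diff (isOpen_lt continuous_const hL.1)
  have hKΩ : closure Ω \ {x | -ε < L x} ⊆ Ω := by
    rintro x ⟨hx, hx'⟩
    by_contra hxΩ
    exact hx' (hLf ⟨hx, by rwa [hΩo.interior_eq]⟩)
  obtain ⟨η, hη, hth⟩ := hK.exists_thickening_subset_open hΩo hKΩ
  refine ⟨L, hL, η, hη, fun x hx z hz hd => ?_⟩
  by_contra! hlt
  exact hz (hth (mem_thickening_iff.2 ⟨x, ⟨subset_closure hx, not_lt.2 hlt.le⟩, hd⟩))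

/-- The key monotone translation estimate: shifted admissible functions lowered by `ε` can be
glued to stay admissible. -/
lemma exists_translate_mem_perronClass {L v : En n → ℝ} {ε η : ℝ} (hε : 0 ≤ ε)
    (hL : L ∈ perronClass H Ω δ) (hΩo : IsOpen Ω)
    (hbd : ∀ x ∈ Ω, ∀ z ∉ Ω, dist z x < η → -ε ≤ L x) (hv : v ∈ perronClass H Ω δ)
    {h : En n} (hh : ‖h‖ < η) :
    ∃ w ∈ perronClass H Ω δ, ∀ x, v (x + h) - ε ≤ w x := by
  have hm := max_mem_perronClass hL hv
  refine ⟨fun x => max (max (L x) (v x)) (max (L (x + h)) (v (x + h)) - ε), ⟨?_, ?_, ?_⟩, ?_⟩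
  · exact hm.1.max ((hm.1.comp (continuous_id.add continuous_const)).sub continuous_const)
  · intro x
    refine max_le (hm.2.1 x) ?_
    have : max (L (x + h)) (v (x + h)) ≤ 0 := hm.2.1 (x + h)
    linarith
  · intro φ hφ y hy hmax
    have hmax' := hmax.isLocalMax (hΩo.mem_nhds hy)
    by_cases hcase : max (L (y + h)) (v (y + h)) - ε ≤ max (L y) (v y)
    · refine hm.2.2 φ hφ y hy (IsLocalMax.on ?_ _)
      exact isLocalMax_of_touching (w := fun x => max (L x) (v x))
        (Eventually.of_forall fun x => le_max_left _ (max (L (x + h)) (v (x + h)) - ε))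
        (max_eq_left hcase).symm hmax'
    · rw [not_le] at hcase
      have hyh : y + h ∈ Ω := by
        by_contra hyh
        have h1 := hbd y hy (y + h) hyh (by simpa using hh)
        have h2 := le_max_left (L y) (v y)
        have h3 : max (L (y + h)) (v (y + h)) ≤ 0 := hm.2.1 (y + h)
        linarith
      have h1 : IsLocalMax (fun x => (max (L (x + h)) (v (x + h)) - ε) - φ x) y :=
        isLocalMax_of_touching (w := fun x => max (L (x + h)) (v (x + h)) - ε)
          (Eventually.of_forall fun x => le_max_right (max (L x) (v x)) _)
          (max_eq_right hcase.le).symm hmax'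
      have hψ : ContDiff ℝ 2 fun x => φ (x + -h) := hφ.comp (contDiff_id.add contDiff_const)
      have h2 := hm.2.2 _ hψ (y + h) hyh (IsLocalMax.on ?_ _)
      · have hH := (hφ.hasHessAt y)
        have hH' : HasHessAt (fun x => φ (x + -h)) (fun x => gradient φ (x + -h))
            (fderiv ℝ (gradient φ) y) (y + h) :=
          HasHessAt.comp_add_const (-h) (by simpa using hH)
        rw [hH'.gradient_eq, hH'.ehess_eq, ← hH.ehess_eq] at h2
        simpa using h2
      · have hc : Tendsto (fun x => x + -h) (nhds (y + h)) (nhds y) := by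
          have : Continuous fun x : En n => x + -h := by fun_prop
          simpa using this.tendsto (y + h)
        filter_upwards [hc.eventually h1] with x hx
        simp only [neg_add_cancel_right, add_neg_cancel_right] at hx ⊢
        linarith
  · intro x
    have := le_max_right (L (x + h)) (v (x + h))
    exact le_max_of_le_right (by linarith)

/-- The upper envelope of the admissible class, extended by zero. -/
lemma exists_greatest_perronClass (hA : CondA H) (hB : CondB H k₁) (hC : OuterCoercive H)
    (hΩo : IsOpen Ω) (hΩn : Ω.Nonempty) (hΩb : Bornology.IsBounded Ω) (hOB : OuterBallCond Ω)
    (hne : (perronClass H Ω δ).Nonempty) :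
    ∃ u ∈ perronClass H Ω δ, (∀ x ∉ Ω, u x = 0) ∧
      ∀ v ∈ perronClass H Ω δ, ∀ x ∈ Ω, v x ≤ u x := by
  classical
  set S := perronClass H Ω δ with hS
  let u : En n → ℝ := fun x => if x ∈ Ω then sSup ((fun v : En n → ℝ => v x) '' S) else 0
  have hlub : ∀ x ∈ Ω, IsLUB ((fun v : En n → ℝ => v x) '' S) (u x) := by
    intro x hx
    simp only [u, if_pos hx]
    exact isLUB_csSup (hne.image _) ⟨0, by rintro _ ⟨v, hv, rfl⟩; exact hv.2.1 x⟩
  have hge : ∀ v ∈ S, ∀ x ∈ Ω, v x ≤ u x := fun v hv x hx => (hlub x hx).1 ⟨v, hv, rfl⟩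
  have hout : ∀ x ∉ Ω, u x = 0 := fun x hx => if_neg hx
  have hle : ∀ x, u x ≤ 0 := by
    intro x
    by_cases hx : x ∈ Ω
    · exact (hlub x hx).2 (by rintro _ ⟨v, hv, rfl⟩; exact hv.2.1 x)
    · exact (hout x hx).le
  have hmod : ∀ ε > 0, ∃ η > 0, ∀ x x', dist x x' < η → u x' - ε ≤ u x := by
    intro ε hε
    obtain ⟨L, hL, η, hη, hbd⟩ := exists_uniform_barrier (δ := δ) hA hB hC hΩo hΩn hΩb hOB hne hε
    refine ⟨η, hη, fun x x' hd => ?_⟩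
    by_cases hx : x ∈ Ω
    · by_cases hx' : x' ∈ Ω
      · rw [sub_le_iff_le_add]
        refine (hlub x' hx').2 ?_
        rintro _ ⟨v, hv, rfl⟩
        obtain ⟨w, hw, hvw⟩ := exists_translate_mem_perronClass hε.le hL hΩo hbd hv
          (h := x' - x) (by rwa [← dist_eq_norm, dist_comm])
        have h1 := hvw x
        have h2 := hge w hw x hx
        simp only [add_sub_cancel] at h1
        simp only
        linarith
      · have h1 := hbd x hx x' hx' (by rwa [dist_comm])
        have h2 := hge L hL x hx
        rw [hout x' hx']
        linarith
    · have := hle x'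
      rw [hout x hx]
      linarith
  have hcont : Continuous u := by
    refine Metric.continuous_iff.2 fun x ε hε => ?_
    obtain ⟨η, hη, hu⟩ := hmod (ε / 2) (by positivity)
    refine ⟨η, hη, fun x' hd => ?_⟩
    have h1 := hu x' x hd
    have h2 := hu x x' (by rwa [dist_comm])
    rw [Real.dist_eq, abs_lt]
    constructor <;> linarith
  exact ⟨u, ⟨hcont, hle, ellSub_of_isLUB hA hΩo (fun v hv => hv.1) (fun v hv => hv.2.2) hlub⟩,
    hout, hge⟩

/-- The greatest admissible function is a supersolution. -/
lemma ellSuper_of_greatest (hA : CondA H) (hΩo : IsOpen Ω) (hδ : 0 < δ) {u : En n → ℝ}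
    (hu : u ∈ perronClass H Ω δ) (hmax : ∀ v ∈ perronClass H Ω δ, ∀ x ∈ Ω, v x ≤ u x) :
    EllSuper H Ω u (fun _ => δ) := by
  intro φ hφ y hy hm
  by_contra! hlt
  have hm' := hm.isLocalMin (hΩo.mem_nhds hy)
  have hφc := hφ.continuous
  rcases (hu.2.1 y).eq_or_lt with huy | huy
  · have h0 : HasHessAt (fun _ : En n => (0:ℝ)) (fun _ => 0) (0 : En n →L[ℝ] En n) y :=
      ⟨Eventually.of_forall fun x => by
        rw [hasGradientAt_iff_hasFDerivAt, map_zero]; exact hasFDerivAt_const _ _,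
        hasFDerivAt_const _ _⟩
    have h1 := (hφ.hasHessAt y).le_of_isLocalMax hA h0 (by
      filter_upwards [hm'] with x hx
      have := hu.2.1 x
      linarith)
    have hz : hessMat (0 : En n →L[ℝ] En n) = 0 := by ext i j; simp [hessMat]
    rw [hz, hA.2.1, ← (hφ.hasHessAt y).ehess_eq] at h1
    linarith
  · have hcont := continuous_quadratic_perturbation hA hφ y
    have hnear : ∀ᶠ z in nhds ((0:ℝ), y), δ < H (gradient φ z.2 + (2 * z.1) • (z.2 - y))
        (ehess φ z.2 + (2 * z.1) • (1 : Sym n)) :=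
      hcont.continuousAt.eventually (lt_mem_nhds (by simpa using hlt))
    obtain ⟨r₁, hr₁, hball⟩ := Metric.eventually_nhds_iff.1 hnear
    have hφy : ∀ᶠ x in nhds y, φ x - φ y < -u y / 2 :=
      (hφc.sub continuous_const).continuousAt.eventually (gt_mem_nhds (by simp; linarith))
    obtain ⟨r₂, hr₂, hball₂⟩ := Metric.eventually_nhds_iff.1 (hm'.and hφy)
    set κ : ℝ := r₁ / 2 with hκ
    set r : ℝ := min r₁ r₂ / 2 with hr
    have hκ0 : 0 < κ := by positivity
    have hr0 : 0 < r := by positivity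
    have hrr₁ : r < r₁ := by have := min_le_left r₁ r₂; have := lt_min hr₁ hr₂; linarith
    have hrr₂ : r < r₂ := by have := min_le_right r₁ r₂; have := lt_min hr₁ hr₂; linarith
    have hκr : 0 < κ * r ^ 2 := by positivity
    set σ : ℝ := min (κ * r ^ 2) (-u y / 2) with hσ
    have hσ0 : 0 < σ := lt_min hκr (by linarith)
    have hσ1 : σ ≤ κ * r ^ 2 := min_le_left _ _
    have hσ2 : σ ≤ -u y / 2 := min_le_right _ _
    set b : En n → ℝ := fun x => (u y - φ y + σ) + (φ x + (-κ) * ‖x - y‖ ^ 2) with hb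
    have hbc : Continuous b := by fun_prop
    have hbH : ∀ x, HasHessAt b (fun x => gradient φ x + (2 * (-κ)) • (x - y))
        (fderiv ℝ (gradient φ) x + radialHess (-κ) 0 (x - y)) x := fun x =>
      (hasHessAt_quadratic_perturbation hφ (-κ) y x).1.const_add _
    have hbsphere : ∀ x, dist x y = r → b x ≤ u x := by
      intro x hx
      have h1 := (hball₂ (hx.trans_lt hrr₂)).1
      simp only [hb, ← dist_eq_norm, hx]
      linarith
    let v : En n → ℝ := fun x => if dist x y ≤ r then max (u x) (b x) else u x
    have hv : v ∈ perronClass H Ω δ := by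
      refine ⟨?_, ?_, ?_⟩
      · exact Continuous.if_le (hu.1.max hbc) hu.1 (by fun_prop) continuous_const
          fun x hx => max_eq_left (hbsphere x hx)
      · intro x
        simp only [v]
        split_ifs with hx
        · refine max_le (hu.2.1 x) ?_
          have h1 := (hball₂ (hx.trans_lt hrr₂)).2
          have h2 : 0 ≤ κ * ‖x - y‖ ^ 2 := by positivity
          simp only [hb]
          linarith
        · exact hu.2.1 x
      · intro ψ hψ x hx hxm
        have hxm' := hxm.isLocalMax (hΩo.mem_nhds hx)
        have huv : ∀ z, u z ≤ v z := fun z => by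
          simp only [v]; split_ifs
          · exact le_max_left _ _
          · exact le_rfl
        by_cases hcase : u x = v x
        · exact hu.2.2 ψ hψ x hx ((isLocalMax_of_touching (Eventually.of_forall huv)
            hcase hxm').on _)
        · have hxr : dist x y < r ∧ u x < b x := by
            by_contra! hcon
            apply hcase
            simp only [v]
            split_ifs with hxr
            · refine (max_eq_left ?_).symm
              rcases hxr.eq_or_lt with h | h
              · exact hbsphere x h
              · exact hcon h
            · rfl
          have hbv : ∀ᶠ z in nhds x, b z ≤ v z := by
            filter_upwards [isOpen_ball.mem_nhds (show x ∈ ball y r from hxr.1)] with z hz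
            simp only [v, if_pos (show dist z y ≤ r from (mem_ball.1 hz).le)]
            exact le_max_right _ _
          have hbx : b x = v x := by
            simp only [v, if_pos hxr.1.le, max_eq_right hxr.2.le]
          have h1 := (hbH x).le_of_isLocalMax hA (hψ.hasHessAt x)
            (isLocalMax_of_touching hbv hbx hxm')
          rw [(hasHessAt_quadratic_perturbation hφ (-κ) y x).2,
            ← (hψ.hasHessAt x).ehess_eq] at h1
          refine le_trans (hball (y := (-κ, x)) ?_).le h1
          rw [Prod.dist_eq, max_lt_iff]
          refine ⟨?_, hxr.1.trans hrr₁⟩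
          rw [Real.dist_eq, sub_zero, abs_neg, abs_of_pos hκ0]
          linarith
    have h1 := hmax v hv y hy
    have h2 : b y ≤ v y := by
      simp only [v, dist_self, if_pos hr0.le]
      exact le_max_right _ _
    simp only [hb, sub_self, norm_zero] at h2
    linarith

/-- Solvability of the homogeneous Dirichlet problem with positive right-hand side. -/
lemma exists_solution_of_pos (hn : 2 ≤ n) (hA : CondA H) (hB : CondB H k₁)
    (hC : OuterCoercive H) (hΩo : IsOpen Ω) (hΩn : Ω.Nonempty)
    (hΩb : Bornology.IsBounded Ω) (hOB : OuterBallCond Ω) (hδ : 0 < δ) :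
    ∃ u : En n → ℝ, Continuous u ∧ (∀ x, u x ≤ 0) ∧ EllSub H Ω u (fun _ => δ) ∧
      EllSuper H Ω u (fun _ => δ) ∧ ∀ x ∉ Ω, u x = 0 := by
  have hne : (perronClass H Ω δ).Nonempty := by
    have : Nonempty (Fin n) := ⟨⟨0, by omega⟩⟩
    have hfr : (frontier Ω).Nonempty := by
      rw [nonempty_iff_ne_empty, Ne, frontier_eq_empty_iff]
      rintro (h | h)
      · exact hΩn.ne_empty h
      · exact NormedSpace.unbounded_univ ℝ (En n) (h ▸ hΩb)
    obtain ⟨y, hy⟩ := hfr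
    obtain ⟨ρ, hρ, q, -, hball, -⟩ := hOB y hy
    obtain ⟨w, hw, -⟩ := exists_barrier (δ := δ) hA hB hC hΩo hΩn hΩb hρ hball
    exact ⟨w, hw⟩
  obtain ⟨u, hu, hu0, hmax⟩ := exists_greatest_perronClass hA hB hC hΩo hΩn hΩb hOB hne
  exact ⟨u, hu.1, hu.2.1, hu.2.2, ellSuper_of_greatest hA hΩo hδ hu hmax, hu0⟩

end Perron

/-! ### Reflection and scaling -/

section Transform

variable {H : En n → Sym n → ℝ} {k₁ : ℝ} {Ω : Set (En n)}

/-- The operator satisfied by `-u` when `u` satisfies `H`. -/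
def reflect (H : En n → Sym n → ℝ) : En n → Sym n → ℝ := fun p X => -H (-p) (-X)

lemma CondA.reflect (hA : CondA H) : CondA (reflect H) := by
  refine ⟨?_, fun p => by simp [DNLP.reflect, hA.2.1], fun p X Y h => ?_⟩
  · exact (hA.1.comp (f := fun q : En n × Sym n => (-q.1, -q.2)) (by fun_prop)).neg
  · refine neg_le_neg (hA.2.2 _ _ _ ?_)
    simpa [LoewnerLE, neg_add_eq_sub] using h

lemma CondB.reflect (hB : CondB H k₁) : CondB (reflect H) k₁ := by
  refine ⟨hB.1, fun θ p X => ?_, fun θ hθ p X => ?_⟩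
  · simp only [DNLP.reflect, ← smul_neg, hB.2.1, mul_neg]
  · simp only [DNLP.reflect, ← smul_neg, hB.2.2 θ hθ, mul_neg]

lemma CondC.outerCoercive (hC : CondC H) : OuterCoercive H := by
  obtain ⟨Λ₁, -, h⟩ := hC.2
  exact ⟨Λ₁, fun Λ hΛ e he => (h Λ hΛ e he).2⟩

lemma CondC.outerCoercive_reflect (hC : CondC H) : OuterCoercive (reflect H) := by
  obtain ⟨Λ₁, -, h⟩ := hC.2
  refine ⟨Λ₁, fun Λ hΛ e he => ?_⟩
  have := (h Λ hΛ (-e) (by rwa [norm_neg])).1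
  have hv : vouter (-e) (-e) = vouter e e := by ext i j; simp [vouter]
  rw [hv] at this
  simpa [reflect] using this

lemma gradient_const_add_mul {φ : En n → ℝ} (hφ : ContDiff ℝ 2 φ) (b a : ℝ) (y : En n) :
    gradient (fun x => b + a * φ x) y = a • gradient φ y :=
  (((hφ.hasHessAt y).const_mul a).const_add b).gradient_eq

lemma ehess_const_add_mul {φ : En n → ℝ} (hφ : ContDiff ℝ 2 φ) (b a : ℝ) (y : En n) :
    ehess (fun x => b + a * φ x) y = a • ehess φ y := by
  rw [(((hφ.hasHessAt y).const_mul a).const_add b).ehess_eq, hessMat_smul,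
    (hφ.hasHessAt y).ehess_eq]

lemma gradient_neg' {φ : En n → ℝ} (hφ : ContDiff ℝ 2 φ) (y : En n) :
    gradient (fun x => -φ x) y = -gradient φ y := by
  simpa using gradient_const_add_mul hφ 0 (-1) y

lemma ehess_neg {φ : En n → ℝ} (hφ : ContDiff ℝ 2 φ) (y : En n) :
    ehess (fun x => -φ x) y = -ehess φ y := by
  simpa using ehess_const_add_mul hφ 0 (-1) y

lemma EllSuper.neg_of_reflect {u : En n → ℝ} {δ : ℝ}
    (hu : EllSuper (reflect H) Ω u (fun _ => δ)) : EllSub H Ω (fun x => -u x) (fun _ => -δ) := by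
  intro φ hφ y hy hm
  have := hu _ hφ.neg y hy (by
    filter_upwards [hm] with x hx
    linarith)
  rw [gradient_neg' hφ, ehess_neg hφ] at this
  simp only [reflect, neg_neg] at this
  linarith

lemma EllSub.neg_of_reflect {u : En n → ℝ} {δ : ℝ}
    (hu : EllSub (reflect H) Ω u (fun _ => δ)) : EllSuper H Ω (fun x => -u x) (fun _ => -δ) := by
  intro φ hφ y hy hm
  have := hu _ hφ.neg y hy (by
    filter_upwards [hm] with x hx
    linarith)
  rw [gradient_neg' hφ, ehess_neg hφ] at this
  simp only [reflect, neg_neg] at this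
  linarith

lemma CondB.apply_smul_smul (hB : CondB H k₁) {a : ℝ} (ha : 0 < a) (p : En n) (X : Sym n) :
    H (a • p) (a • X) = a ^ (k₁ + 1) * H p X := by
  rw [hB.2.1, hB.2.2 a ha, abs_of_pos ha, Real.rpow_add_one ha.ne']
  ring

lemma EllSub.const_add_mul (hB : CondB H k₁) {u : En n → ℝ} {δ c : ℝ} (hc : 0 < c) (θ : ℝ)
    (hu : EllSub H Ω u (fun _ => δ)) :
    EllSub H Ω (fun x => θ + c * u x) (fun _ => c ^ (k₁ + 1) * δ) := by
  intro φ hφ y hy hm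
  have h := hu (fun x => 0 + c⁻¹ * φ x) (contDiff_const.add (contDiff_const.mul hφ)) y hy (by
    filter_upwards [hm] with x hx
    have := mul_le_mul_of_nonneg_left hx (inv_nonneg.2 hc.le)
    field_simp at this ⊢
    linarith)
  rw [gradient_const_add_mul hφ, ehess_const_add_mul hφ,
    hB.apply_smul_smul (inv_pos.2 hc), Real.inv_rpow hc.le] at h
  rwa [← le_inv_mul_iff₀ (Real.rpow_pos_of_pos hc _)]

lemma EllSuper.const_add_mul (hB : CondB H k₁) {u : En n → ℝ} {δ c : ℝ} (hc : 0 < c) (θ : ℝ)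
    (hu : EllSuper H Ω u (fun _ => δ)) :
    EllSuper H Ω (fun x => θ + c * u x) (fun _ => c ^ (k₁ + 1) * δ) := by
  intro φ hφ y hy hm
  have h := hu (fun x => 0 + c⁻¹ * φ x) (contDiff_const.add (contDiff_const.mul hφ)) y hy (by
    filter_upwards [hm] with x hx
    have := mul_le_mul_of_nonneg_left hx (inv_nonneg.2 hc.le)
    field_simp at this ⊢
    linarith)
  rw [gradient_const_add_mul hφ, ehess_const_add_mul hφ,
    hB.apply_smul_smul (inv_pos.2 hc), Real.inv_rpow hc.le] at h
  rwa [← inv_mul_le_iff₀ (Real.rpow_pos_of_pos hc _)]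

end Transform

/-- existence for the auxiliary elliptic Dirichlet problem
H(Dψ,D²ψ) = δ in Ω, ψ = θ on ∂Ω, for domains with an outer ball condition. -/
theorem elliptic_existence
    {n : ℕ} (hn : 2 ≤ n)
    (H : En n → Sym n → ℝ) (k₁ k : ℝ) (hk : k = k₁ + 1) (hk1 : 1 ≤ k)
    (hA : CondA H) (hB : CondB H k₁) (hC : CondC H)
    (Ω : Set (En n)) (hΩo : IsOpen Ω) (hΩc : IsConnected Ω)
    (hΩb : Bornology.IsBounded Ω) (hOB : OuterBallCond Ω)
    (δ θ : ℝ) (hδ : δ ≠ 0) :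
    ∃ ψ η : En n → ℝ,
      ContinuousOn ψ (closure Ω) ∧
      EllSub H Ω ψ (fun _ => δ) ∧
      EllSuper H Ω ψ (fun _ => δ) ∧
      (∀ y ∈ frontier Ω, ψ y = θ) ∧
      (0 < δ → ∀ x ∈ Ω, ψ x ≤ θ) ∧
      (δ < 0 → ∀ x ∈ Ω, θ ≤ ψ x) ∧
      ContinuousOn η (closure Ω) ∧
      EllSub H Ω η (fun _ => δ / |δ|) ∧
      EllSuper H Ω η (fun _ => δ / |δ|) ∧
      (∀ y ∈ frontier Ω, η y = 0) ∧
      (∀ x ∈ closure Ω, ψ x = θ + |δ| ^ (1 / k) * η x) := by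
  obtain ⟨η, hηc, hηsub, hηsup, hη0, hpos, hneg⟩ : ∃ η : En n → ℝ, Continuous η ∧
      EllSub H Ω η (fun _ => δ / |δ|) ∧ EllSuper H Ω η (fun _ => δ / |δ|) ∧
      (∀ x ∉ Ω, η x = 0) ∧ (0 < δ → ∀ x, η x ≤ 0) ∧ (δ < 0 → ∀ x, 0 ≤ η x) := by
    rcases hδ.lt_or_gt with hd | hd
    · obtain ⟨u, hc, hle, hsub, hsup, h0⟩ := exists_solution_of_pos hn hA.reflect hB.reflect
        hC.outerCoercive_reflect hΩo hΩc.nonempty hΩb hOB one_pos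
      have hone : δ / |δ| = -1 := by rw [abs_of_neg hd, div_neg, div_self hδ]
      simp only [hone]
      exact ⟨fun x => -u x, hc.neg, hsup.neg_of_reflect, hsub.neg_of_reflect,
        fun x hx => by simp [h0 x hx], fun h => absurd h hd.not_gt,
        fun _ x => neg_nonneg.2 (hle x)⟩
    · obtain ⟨u, hc, hle, hsub, hsup, h0⟩ := exists_solution_of_pos hn hA hB
        hC.outerCoercive hΩo hΩc.nonempty hΩb hOB one_pos
      have hone : δ / |δ| = 1 := by rw [abs_of_pos hd, div_self hδ]
      simp only [hone]
      exact ⟨u, hc, hsub, hsup, h0, fun _ => hle, fun h => absurd h hd.not_gt⟩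
  have hδ' : 0 < |δ| := abs_pos.2 hδ
  have hc : 0 < |δ| ^ (1 / k) := Real.rpow_pos_of_pos hδ' _
  have hscale : (|δ| ^ (1 / k)) ^ (k₁ + 1) * (δ / |δ|) = δ := by
    rw [← hk, ← Real.rpow_mul hδ'.le, one_div_mul_cancel (by linarith), Real.rpow_one,
      mul_div_cancel₀ _ hδ'.ne']
  have hfr : ∀ y ∈ frontier Ω, η y = 0 := fun y hy =>
    hη0 y (by rw [hΩo.frontier_eq] at hy; exact hy.2)
  have hsub := hηsub.const_add_mul hB hc θ
  have hsup := hηsup.const_add_mul hB hc θ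
  simp only [hscale] at hsub hsup
  refine ⟨fun x => θ + |δ| ^ (1 / k) * η x, η, ?_, hsub, hsup, ?_, ?_, ?_, hηc.continuousOn,
    hηsub, hηsup, hfr, fun _ _ => rfl⟩
  · exact (continuous_const.add (continuous_const.mul hηc)).continuousOn
  · intro y hy
    simp [hfr y hy]
  · intro hd x _
    have := mul_nonpos_of_nonneg_of_nonpos hc.le (hpos hd x)
    simp only
    linarith
  · intro hd x _
    have := mul_nonneg hc.le (hneg hd x)
    simp only
    linarith

end DNLP
end
end
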